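/- arXiv:2511.04844 — 3 statements merged into one kernel-verified Lean document; each statement's English description precedes it below -/
import Mathlib

section
/- There is a universal constant C such that for every d ≥ 1, every probability measure μ on ℝ^d with ∫‖y‖² dμ(y) ≤ M₂² < ∞, and every t > 0, the relative Fisher information satisfies FI(μ_t ‖ γ_d) ≤ C·(d/(1−e^{−2t}) + M₂²). -/
open MeasureTheory Real
open scoped RealInnerProductSpace ENNReal Classical

noncomputable section

/-- `Euc d` is Euclidean space `ℝ^d`. -/
abbrev Euc (d : ℕ) := EuclideanSpace ℝ (Fin d)

/-- The standard Gaussian measure `N(0, I_d)` on `ℝ^d`. -/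
def stdGaussian (d : ℕ) : Measure (Euc d) :=
  volume.withDensity fun x =>
    ENNReal.ofReal ((2 * π) ^ (-(d : ℝ) / 2) * Real.exp (-‖x‖ ^ 2 / 2))

/-- The density `p_t` of the Ornstein–Uhlenbeck flow of `μ` at time `t`. -/
def ouDensity (d : ℕ) (μ : Measure (Euc d)) (t : ℝ) (x : Euc d) : ℝ :=
  (2 * π * (1 - Real.exp (-2 * t))) ^ (-(d : ℝ) / 2) *
    ∫ y, Real.exp (-‖x - Real.exp (-t) • y‖ ^ 2 / (2 * (1 - Real.exp (-2 * t)))) ∂μ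

/-- The Ornstein–Uhlenbeck flow `μ_t` of `μ` at time `t`, i.e. the measure with
density `p_t` with respect to Lebesgue measure. -/
def ouFlow (d : ℕ) (μ : Measure (Euc d)) (t : ℝ) : Measure (Euc d) :=
  volume.withDensity fun x => ENNReal.ofReal (ouDensity d μ t x)

/-- The relative score `x ↦ ∇ log p_t(x) + x` of `μ_t`. -/
def relScore (d : ℕ) (μ : Measure (Euc d)) (t : ℝ) (x : Euc d) : Euc d :=
  gradient (fun z => Real.log (ouDensity d μ t z)) x + x

/-- The relative Fisher information `FI(μ_t ‖ γ_d) = ∫ ‖∇ log p_t + x‖² dμ_t`. -/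
def relFisher (d : ℕ) (μ : Measure (Euc d)) (t : ℝ) : ℝ :=
  ∫ x, ‖relScore d μ t x‖ ^ 2 ∂(ouFlow d μ t)

/-- Kullback–Leibler divergence `KL(ρ ‖ σ)`. -/
def KLdiv {α : Type*} [MeasurableSpace α] (ρ σ : Measure α) : ℝ≥0∞ :=
  if ρ ≪ σ then ENNReal.ofReal (∫ x, Real.log ((ρ.rnDeriv σ x).toReal) ∂ρ) else ⊤

/-- Cauchy–Schwarz for a vector-valued integral against a nonnegative weight. -/
theorem norm_integral_smul_sq_le {α E : Type*} [MeasurableSpace α] [NormedAddCommGroup E]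
    [NormedSpace ℝ E] {μ : Measure α} {g : α → ℝ} {f : α → E} (hg : ∀ y, 0 ≤ g y)
    (hgi : Integrable g μ) (hgf : Integrable (fun y => g y * ‖f y‖ ^ 2) μ) :
    ‖∫ y, g y • f y ∂μ‖ ^ 2 ≤ (∫ y, g y ∂μ) * ∫ y, g y * ‖f y‖ ^ 2 ∂μ := by
  set N := ‖∫ y, g y • f y ∂μ‖
  have key : ∀ m : ℝ, 0 ≤ (∫ y, g y ∂μ) * (m * m) + (-(2 * N)) * m
      + ∫ y, g y * ‖f y‖ ^ 2 ∂μ := by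
    have hpos : ∀ m : ℝ, 0 ≤ m → 2 * N * m ≤ (∫ y, g y ∂μ) * (m * m)
        + ∫ y, g y * ‖f y‖ ^ 2 ∂μ := by
      intro m hm
      calc 2 * N * m = 2 * m * N := by ring
        _ ≤ 2 * m * ∫ y, ‖g y • f y‖ ∂μ := by
          gcongr
          exact norm_integral_le_integral_norm _
        _ = ∫ y, 2 * m * ‖g y • f y‖ ∂μ := (integral_const_mul _ _).symm
        _ ≤ ∫ y, (g y * (m * m) + g y * ‖f y‖ ^ 2) ∂μ := by
          refine integral_mono_of_nonneg (.of_forall fun y => by positivity)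
            ((hgi.mul_const _).add hgf) (.of_forall fun y => ?_)
          simp only [norm_smul, Real.norm_of_nonneg (hg y)]
          nlinarith [mul_nonneg (hg y) (sq_nonneg (‖f y‖ - m))]
        _ = _ := by rw [integral_add (hgi.mul_const _) hgf, integral_mul_const]
    intro m
    rcases le_total 0 m with hm | hm
    · linarith [hpos m hm]
    · have h1 : 0 ≤ ∫ y, g y ∂μ := integral_nonneg hg
      have h2 : 0 ≤ ∫ y, g y * ‖f y‖ ^ 2 ∂μ :=
        integral_nonneg fun y => mul_nonneg (hg y) (sq_nonneg _)
      have h3 : 0 ≤ N * -m := mul_nonneg (norm_nonneg _) (by linarith)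
      nlinarith [mul_nonneg h1 (mul_self_nonneg m)]
  have := discrim_le_zero key
  rw [discrim] at this
  linarith

theorem mul_exp_neg_mul_le {b : ℝ} (hb : 0 < b) (s : ℝ) : s * exp (-b * s) ≤ 1 / b := by
  have h : b * s ≤ exp (b * s) := by linarith [add_one_le_exp (b * s)]
  have : b * (s * exp (-b * s)) ≤ 1 := by
    calc b * (s * exp (-b * s)) = b * s * exp (-b * s) := by ring
      _ ≤ exp (b * s) * exp (-b * s) := by gcongr
      _ = 1 := by rw [← exp_add]; simp
  rw [le_div_iff₀ hb]
  linarith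

section GaussianConvolution

variable {d : ℕ} {μ : Measure (Euc d)} [IsProbabilityMeasure μ]

theorem integrable_gaussianKernel {b : ℝ} (hb : 0 < b) (a : ℝ) (x : Euc d) :
    Integrable (fun y => exp (-b * ‖x - a • y‖ ^ 2)) μ := by
  refine Integrable.of_bound (C := 1) (by fun_prop) (.of_forall fun y => ?_)
  rw [Real.norm_of_nonneg (exp_pos _).le, exp_le_one_iff]
  nlinarith [sq_nonneg ‖x - a • y‖]

theorem integrable_gaussianKernel_mul_sq {b : ℝ} (hb : 0 < b) (a : ℝ) (x : Euc d) :
    Integrable (fun y => ‖x - a • y‖ ^ 2 * exp (-b * ‖x - a • y‖ ^ 2)) μ := by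
  refine Integrable.of_bound (C := 1 / b) (by fun_prop) (.of_forall fun y => ?_)
  rw [Real.norm_of_nonneg (by positivity)]
  exact mul_exp_neg_mul_le hb _

theorem integrable_gaussianKernel_smul {b : ℝ} (hb : 0 < b) (a : ℝ) (x : Euc d) :
    Integrable (fun y => exp (-b * ‖x - a • y‖ ^ 2) • (x - a • y)) μ := by
  refine ((integrable_gaussianKernel hb a x).add
    (integrable_gaussianKernel_mul_sq hb a x)).mono' (by fun_prop) (.of_forall fun y => ?_)
  simp only [norm_smul, Real.norm_of_nonneg (exp_pos _).le, Pi.add_apply]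
  nlinarith [mul_nonneg (exp_pos (-b * ‖x - a • y‖ ^ 2)).le (sq_nonneg (‖x - a • y‖ - 1 / 2)),
    exp_pos (-b * ‖x - a • y‖ ^ 2)]

theorem hasGradientAt_gaussianConvolution {b : ℝ} (hb : 0 < b) (a : ℝ) (x : Euc d) :
    HasGradientAt (fun z => ∫ y, exp (-b * ‖z - a • y‖ ^ 2) ∂μ)
      ((-(2 * b)) • ∫ y, exp (-b * ‖x - a • y‖ ^ 2) • (x - a • y) ∂μ) x := by
  let F' : Euc d → Euc d → (Euc d →L[ℝ] ℝ) := fun z y =>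
    exp (-b * ‖z - a • y‖ ^ 2) • ((-(2 * b)) • innerSL ℝ (z - a • y))
  have hF' : ∀ z, Continuous (F' z) := fun z => by
    simp only [F']
    fun_prop
  have hbound : ∀ z y, ‖F' z y‖ ≤ 2 * b * (1 + 1 / b) := by
    intro z y
    have h1 := mul_exp_neg_mul_le hb (‖z - a • y‖ ^ 2)
    have h2 : exp (-b * ‖z - a • y‖ ^ 2) ≤ 1 := by
      rw [exp_le_one_iff]
      nlinarith [sq_nonneg ‖z - a • y‖]
    have h3 := mul_nonneg (exp_pos (-b * ‖z - a • y‖ ^ 2)).le (sq_nonneg (‖z - a • y‖ - 1 / 2))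
    simp only [F', norm_smul, innerSL_apply_norm, norm_neg,
      Real.norm_of_nonneg (exp_pos _).le]
    rw [Real.norm_of_nonneg (by positivity : (0:ℝ) ≤ 2 * b), mul_left_comm]
    gcongr
    nlinarith [exp_pos (-b * ‖z - a • y‖ ^ 2)]
  have hderiv : HasFDerivAt (fun z => ∫ y, exp (-b * ‖z - a • y‖ ^ 2) ∂μ)
      (∫ y, F' x y ∂μ) x := by
    refine hasFDerivAt_integral_of_dominated_of_fderiv_le (s := Set.univ)
      (bound := fun _ => 2 * b * (1 + 1 / b)) Filter.univ_mem
      (.of_forall fun z => by fun_prop) (integrable_gaussianKernel hb a x)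
      (hF' x).aestronglyMeasurable (.of_forall fun y z _ => hbound z y)
      (integrable_const _) (.of_forall fun y z _ => ?_)
    have := (((hasFDerivAt_id z).sub_const (a • y)).norm_sq.const_mul (-b)).exp
    refine this.congr_fderiv ?_
    ext u
    simp [F']
    ring
  have h_integrable : Integrable (F' x) μ :=
    Integrable.of_bound (hF' x).aestronglyMeasurable _ (.of_forall (hbound x))
  refine hderiv.congr_fderiv ?_
  ext u
  rw [ContinuousLinearMap.integral_apply h_integrable, InnerProductSpace.toDual_apply_apply,
    real_inner_comm, real_inner_smul_right,
    ← integral_inner (integrable_gaussianKernel_smul hb a x), ← integral_const_mul]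
  refine integral_congr_ae (.of_forall fun y => ?_)
  simp only [F', smul_apply, innerSL_apply_apply, smul_eq_mul,
    real_inner_smul_right, real_inner_comm u]
  ring

theorem gaussianConvolution_pos {b : ℝ} (hb : 0 < b) (a : ℝ) (x : Euc d) :
    0 < ∫ y, exp (-b * ‖x - a • y‖ ^ 2) ∂μ :=
  integral_exp_pos (integrable_gaussianKernel hb a x)

/-- The squared relative score, weighted by the density, is at most the integral of the squared
conditional relative score against the Gaussian kernel. -/
theorem gaussianConvolution_mul_norm_score_sq_le {b : ℝ} (hb : 0 < b) {c : ℝ} (hc : 0 < c)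
    (a : ℝ) (x : Euc d) :
    (∫ y, exp (-b * ‖x - a • y‖ ^ 2) ∂μ) *
      ‖gradient (fun z => log (c * ∫ y, exp (-b * ‖z - a • y‖ ^ 2) ∂μ)) x + x‖ ^ 2 ≤
    ∫ y, exp (-b * ‖x - a • y‖ ^ 2) * ‖x - (2 * b) • (x - a • y)‖ ^ 2 ∂μ := by
  set F := ∫ y, exp (-b * ‖x - a • y‖ ^ 2) ∂μ with hF
  have hFpos : 0 < F := gaussianConvolution_pos hb a x
  have hg := hasGradientAt_gaussianConvolution (μ := μ) hb a x
  set V := ∫ y, exp (-b * ‖x - a • y‖ ^ 2) • (x - a • y) ∂μ with hV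
  have hlog : HasGradientAt (fun z => log (c * ∫ y, exp (-b * ‖z - a • y‖ ^ 2) ∂μ))
      (F⁻¹ • (-(2 * b)) • V) x := by
    rw [hasGradientAt_iff_hasFDerivAt] at hg ⊢
    refine ((hg.const_mul c).log (by positivity)).congr_fderiv ?_
    ext u
    simp [-neg_mul, ← hF]
    field_simp
  rw [hlog.gradient]
  have hI : ∫ y, exp (-b * ‖x - a • y‖ ^ 2) • (x - (2 * b) • (x - a • y)) ∂μ
      = F • x - (2 * b) • V := by
    have h1 := (integrable_gaussianKernel (μ := μ) hb a x).smul_const x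
    have h2 := (integrable_gaussianKernel_smul (μ := μ) hb a x).fun_smul (2 * b)
    rw [hF, hV, ← integral_smul_const, ← integral_smul, ← integral_sub h1 h2]
    refine integral_congr_ae (.of_forall fun y => ?_)
    simp only [smul_sub, smul_comm (2 * b)]
  have hvec : F⁻¹ • (-(2 * b)) • V + x = F⁻¹ • (F • x - (2 * b) • V) := by
    rw [smul_sub, smul_smul F⁻¹ F, inv_mul_cancel₀ hFpos.ne', one_smul, neg_smul, smul_neg]
    abel
  have h_integrable : Integrable
      (fun y => exp (-b * ‖x - a • y‖ ^ 2) * ‖x - (2 * b) • (x - a • y)‖ ^ 2) μ := by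
    refine (((integrable_gaussianKernel hb a x).const_mul (2 * ‖x‖ ^ 2)).add
      ((integrable_gaussianKernel_mul_sq hb a x).const_mul (2 * (2 * b) ^ 2))).mono'
      (by fun_prop) (.of_forall fun y => ?_)
    rw [Real.norm_of_nonneg (by positivity)]
    have h1 : ‖x - (2 * b) • (x - a • y)‖ ^ 2 ≤
        2 * ‖x‖ ^ 2 + 2 * (2 * b) ^ 2 * ‖x - a • y‖ ^ 2 := by
      have h2 := norm_sub_le x ((2 * b) • (x - a • y))
      rw [norm_smul, Real.norm_of_nonneg (by positivity : (0:ℝ) ≤ 2 * b)] at h2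
      nlinarith [norm_nonneg (x - (2 * b) • (x - a • y)),
        sq_nonneg (‖x‖ - 2 * b * ‖x - a • y‖)]
    calc _ ≤ exp (-b * ‖x - a • y‖ ^ 2) *
          (2 * ‖x‖ ^ 2 + 2 * (2 * b) ^ 2 * ‖x - a • y‖ ^ 2) := by gcongr
      _ = _ := by
        simp only [Pi.add_apply]
        ring
  have hcs := norm_integral_smul_sq_le (fun y => (exp_pos (-b * ‖x - a • y‖ ^ 2)).le)
    (integrable_gaussianKernel (μ := μ) hb a x) h_integrable
  rw [hI, ← hF] at hcs
  rw [hvec, norm_smul, mul_pow, norm_inv, Real.norm_of_nonneg hFpos.le]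
  calc F * (F⁻¹ ^ 2 * ‖F • x - (2 * b) • V‖ ^ 2)
      = F⁻¹ * ‖F • x - (2 * b) • V‖ ^ 2 := by field_simp
    _ ≤ F⁻¹ * (F * _) := by gcongr
    _ = _ := by field_simp

end GaussianConvolution

theorem norm_conditional_score_sq_le {d : ℕ} {a b : ℝ} (ha : a ^ 2 ≤ 1)
    (hb : 0 < b) (hab : 2 * b * (1 - a ^ 2) = 1) (x y : Euc d) :
    ‖x - (2 * b) • (x - a • y)‖ ^ 2 ≤ 2 * ‖y‖ ^ 2 + 8 * b ^ 2 * ‖x - a • y‖ ^ 2 := by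
  have h1 : x - (2 * b) • (x - a • y) = a • y - (2 * b * a ^ 2) • (x - a • y) := by
    have : 2 * b * a ^ 2 = 2 * b - 1 := by linarith
    rw [this]
    module
  have h2 := norm_sub_le (a • y) ((2 * b * a ^ 2) • (x - a • y))
  rw [← h1, norm_smul, norm_smul, Real.norm_eq_abs,
    Real.norm_of_nonneg (by positivity : (0:ℝ) ≤ 2 * b * a ^ 2)] at h2
  have h3 : |a| ≤ 1 := abs_le_one_iff_mul_self_le_one.2 (by nlinarith)
  have h4 : ‖x - (2 * b) • (x - a • y)‖ ≤ ‖y‖ + 2 * b * ‖x - a • y‖ := by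
    refine h2.trans (add_le_add (mul_le_of_le_one_left (norm_nonneg _) h3) ?_)
    exact mul_le_mul_of_nonneg_right (by nlinarith) (norm_nonneg _)
  nlinarith [norm_nonneg (x - (2 * b) • (x - a • y)), sq_nonneg (‖y‖ - 2 * b * ‖x - a • y‖)]

theorem lintegral_exp_neg_mul_norm_sub_sq {d : ℕ} {b : ℝ} (hb : 0 < b) (z : Euc d) :
    ∫⁻ x, ENNReal.ofReal (exp (-b * ‖x - z‖ ^ 2)) = ENNReal.ofReal ((π / b) ^ (d / 2 : ℝ)) := by
  rw [lintegral_sub_right_eq_self (fun x : Euc d => ENNReal.ofReal (exp (-b * ‖x‖ ^ 2))) z]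
  have h := GaussianFourier.integral_rexp_neg_mul_sq_norm (V := Euc d) hb
  rw [finrank_euclideanSpace_fin] at h
  rw [← h, ofReal_integral_eq_lintegral_ofReal]
  · exact Integrable.of_integral_ne_zero (by rw [h]; positivity)
  · exact .of_forall fun x => (exp_pos _).le

theorem one_sub_inv_rpow_neg_le {d : ℕ} (hd : 1 ≤ d) :
    (1 - 1 / (2 * (d : ℝ))) ^ (-(d : ℝ) / 2) ≤ 2 := by
  have hd' : (1 : ℝ) ≤ d := by exact_mod_cast hd
  have h0 : 1 / (2 * (d : ℝ)) ≤ 1 / 2 := by gcongr; linarith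
  set q := 1 - 1 / (2 * (d : ℝ)) with hq
  have hq2 : 1 / 2 ≤ q := by linarith
  have hbern : 1 / 2 ≤ q ^ d := by
    have := one_add_mul_le_pow (a := -(1 / (2 * (d : ℝ)))) (by linarith) d
    rw [← sub_eq_add_neg, ← hq] at this
    calc (1 / 2 : ℝ) = 1 + d * -(1 / (2 * (d : ℝ))) := by field_simp; norm_num
      _ ≤ _ := this
  have hq1 : q ≤ 1 := by
    have : 0 ≤ 1 / (2 * (d : ℝ)) := by positivity
    linarith
  calc q ^ (-(d : ℝ) / 2) ≤ q ^ (-(d : ℝ)) :=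
        rpow_le_rpow_of_exponent_ge (by linarith) hq1 (by linarith)
    _ = (q ^ d)⁻¹ := by rw [rpow_neg (by linarith), rpow_natCast]
    _ ≤ (1 / 2 : ℝ)⁻¹ := by gcongr
    _ = 2 := by norm_num

theorem lintegral_gaussian_mul_le {d : ℕ} (hd : 1 ≤ d) {b : ℝ} (hb : 0 < b) {A B : ℝ} (hA : 0 ≤ A)
    (hB : 0 ≤ B) (z : Euc d) :
    ∫⁻ x, ENNReal.ofReal ((π / b) ^ (-(d : ℝ) / 2) *
      (exp (-b * ‖x - z‖ ^ 2) * (A + B * ‖x - z‖ ^ 2))) ≤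
      ENNReal.ofReal (A + 4 * d / b * B) := by
  have hd' : (1 : ℝ) ≤ d := by exact_mod_cast hd
  set c := (π / b) ^ (-(d : ℝ) / 2) with hc
  have hcpos : 0 < c := by positivity
  set q := 1 - 1 / (2 * (d : ℝ)) with hq
  have hqpos : 0 < q := by
    have : 1 / (2 * (d : ℝ)) ≤ 1 / 2 := by gcongr; linarith
    linarith
  have hpt : ∀ x : Euc d, c * (exp (-b * ‖x - z‖ ^ 2) * (A + B * ‖x - z‖ ^ 2)) ≤
      c * A * exp (-b * ‖x - z‖ ^ 2) +
        c * (B * (2 * d / b)) * exp (-(b * q) * ‖x - z‖ ^ 2) := by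
    intro x
    set s := ‖x - z‖ ^ 2
    have h1 := mul_exp_neg_mul_le (b := b / (2 * d)) (by positivity) s
    have h2 : exp (-b * s) = exp (-(b / (2 * d)) * s) * exp (-(b * q) * s) := by
      rw [← exp_add, hq]
      congr 1
      field_simp
      ring
    have h3 : s * exp (-b * s) ≤ 2 * d / b * exp (-(b * q) * s) := by
      rw [h2, ← mul_assoc]
      gcongr
      simpa using h1
    calc c * (exp (-b * s) * (A + B * s)) = c * A * exp (-b * s) + c * B * (s * exp (-b * s)) := by
          ring
      _ ≤ c * A * exp (-b * s) + c * B * (2 * d / b * exp (-(b * q) * s)) := by gcongr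
      _ = _ := by ring
  have hc1 : c * (π / b) ^ (d / 2 : ℝ) = 1 := by
    rw [hc, ← rpow_add (by positivity)]
    ring_nf
    simp
  have hc2 : c * (π / (b * q)) ^ (d / 2 : ℝ) ≤ 2 := by
    have : (π / (b * q)) ^ (d / 2 : ℝ) = (π / b) ^ (d / 2 : ℝ) * q ^ (-(d : ℝ) / 2) := by
      rw [← div_div, div_rpow (by positivity) hqpos.le, neg_div, rpow_neg hqpos.le,
        div_eq_mul_inv]
    rw [this, ← mul_assoc, hc1, one_mul]
    exact one_sub_inv_rpow_neg_le hd
  calc _ ≤ ∫⁻ x, (ENNReal.ofReal (c * A) * ENNReal.ofReal (exp (-b * ‖x - z‖ ^ 2)) +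
        ENNReal.ofReal (c * (B * (2 * d / b))) *
          ENNReal.ofReal (exp (-(b * q) * ‖x - z‖ ^ 2))) := by
        refine lintegral_mono fun x => ?_
        rw [← ENNReal.ofReal_mul (by positivity), ← ENNReal.ofReal_mul (by positivity),
          ← ENNReal.ofReal_add (by positivity) (by positivity)]
        exact ENNReal.ofReal_le_ofReal (hpt x)
    _ = ENNReal.ofReal (c * A * (π / b) ^ (d / 2 : ℝ) +
        c * (B * (2 * d / b)) * (π / (b * q)) ^ (d / 2 : ℝ)) := by
        rw [lintegral_add_left (by fun_prop), lintegral_const_mul _ (by fun_prop),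
          lintegral_const_mul _ (by fun_prop), lintegral_exp_neg_mul_norm_sub_sq hb,
          lintegral_exp_neg_mul_norm_sub_sq (by positivity), ← ENNReal.ofReal_mul (by positivity),
          ← ENNReal.ofReal_mul (by positivity),
          ← ENNReal.ofReal_add (by positivity) (by positivity)]
    _ ≤ _ := by
        refine ENNReal.ofReal_le_ofReal ?_
        calc _ = (c * (π / b) ^ (d / 2 : ℝ)) * A +
              (c * (π / (b * q)) ^ (d / 2 : ℝ)) * (B * (2 * d / b)) := by ring
          _ ≤ 1 * A + 2 * (B * (2 * d / b)) := by rw [hc1]; gcongr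
          _ = _ := by ring

theorem integral_le_of_lintegral_ofReal_le {α : Type*} [MeasurableSpace α] {ν : Measure α}
    {f : α → ℝ} (hf : ∀ x, 0 ≤ f x) {K : ℝ} (hK : 0 ≤ K)
    (h : ∫⁻ x, ENNReal.ofReal (f x) ∂ν ≤ ENNReal.ofReal K) : ∫ x, f x ∂ν ≤ K := by
  by_cases hi : Integrable f ν
  · rw [integral_eq_lintegral_of_nonneg_ae (.of_forall hf) hi.aestronglyMeasurable]
    exact ENNReal.toReal_le_of_le_ofReal hK h
  · rwa [integral_undef hi]

theorem ouDensity_eq {d : ℕ} (μ : Measure (Euc d)) (t : ℝ) :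
    ouDensity d μ t = fun x => (π / (1 / (2 * (1 - exp (-2 * t))))) ^ (-(d : ℝ) / 2) *
      ∫ y, exp (-(1 / (2 * (1 - exp (-2 * t)))) * ‖x - exp (-t) • y‖ ^ 2) ∂μ := by
  ext x
  rw [ouDensity]
  congr 2
  · rw [one_div, div_inv_eq_mul]
    ring
  · ext y
    congr 1
    ring

theorem lintegral_relScore_sq_le {d : ℕ} (hd : 1 ≤ d) (μ : Measure (Euc d))
    [IsProbabilityMeasure μ] (hμ : Integrable (fun y => ‖y‖ ^ 2) μ) {t : ℝ} (ht : 0 < t) :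
    ∫⁻ x, ENNReal.ofReal (‖relScore d μ t x‖ ^ 2) ∂(ouFlow d μ t) ≤
      ENNReal.ofReal (2 * (∫ y, ‖y‖ ^ 2 ∂μ) + 16 * (d / (1 - exp (-2 * t)))) := by
  set v := 1 - exp (-2 * t) with hv
  have hvpos : 0 < v := by
    have : exp (-2 * t) < 1 := exp_lt_one_iff.2 (by linarith)
    linarith
  set b := 1 / (2 * v) with hb
  have hbpos : 0 < b := by positivity
  set a := exp (-t) with ha
  have ha2 : a ^ 2 = exp (-2 * t) := by
    rw [ha, ← exp_nat_mul]
    congr 1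
    push_cast
    ring
  have hva : v = 1 - a ^ 2 := by rw [hv, ha2]
  have hab : 2 * b * (1 - a ^ 2) = 1 := by
    rw [← hva, hb]
    field_simp
  set c := (π / b) ^ (-(d : ℝ) / 2) with hc
  have hcpos : 0 < c := by positivity
  have hou : ouDensity d μ t = fun x => c * ∫ y, exp (-b * ‖x - a • y‖ ^ 2) ∂μ :=
    ouDensity_eq μ t
  have hcont : Continuous (ouDensity d μ t) := by
    rw [hou]
    exact continuous_const.mul (continuous_iff_continuousAt.2 fun x =>
      (hasGradientAt_gaussianConvolution hbpos a x).differentiableAt.continuousAt)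
  calc _ ≤ ∫⁻ x, ENNReal.ofReal (ouDensity d μ t x) *
        ENNReal.ofReal (‖relScore d μ t x‖ ^ 2) :=
        lintegral_withDensity_le_lintegral_mul _ hcont.measurable.ennreal_ofReal _
    _ ≤ ∫⁻ x, ∫⁻ y, ENNReal.ofReal (c * (exp (-b * ‖x - a • y‖ ^ 2) *
        (2 * ‖y‖ ^ 2 + 8 * b ^ 2 * ‖x - a • y‖ ^ 2))) ∂μ := by
        refine lintegral_mono fun x => ?_
        have hpos := gaussianConvolution_pos (μ := μ) hbpos a x
        have hle := gaussianConvolution_mul_norm_score_sq_le (μ := μ) hbpos hcpos (a := a) x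
        have h_integrable : Integrable (fun y => c * (exp (-b * ‖x - a • y‖ ^ 2) *
            (2 * ‖y‖ ^ 2 + 8 * b ^ 2 * ‖x - a • y‖ ^ 2))) μ := by
          refine (((hμ.const_mul (2 * c)).add ((integrable_gaussianKernel_mul_sq hbpos a x).const_mul
            (8 * b ^ 2 * c)))).mono' (by fun_prop) (.of_forall fun y => ?_)
          have h1 : exp (-b * ‖x - a • y‖ ^ 2) ≤ 1 := by
            rw [exp_le_one_iff]
            nlinarith [sq_nonneg ‖x - a • y‖]
          rw [Real.norm_of_nonneg (by positivity)]
          calc _ = 2 * c * ‖y‖ ^ 2 * exp (-b * ‖x - a • y‖ ^ 2) + 8 * b ^ 2 * c *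
                (‖x - a • y‖ ^ 2 * exp (-b * ‖x - a • y‖ ^ 2)) := by ring
            _ ≤ 2 * c * ‖y‖ ^ 2 * 1 + 8 * b ^ 2 * c *
                (‖x - a • y‖ ^ 2 * exp (-b * ‖x - a • y‖ ^ 2)) := by gcongr
            _ = _ := by simp
        rw [← ENNReal.ofReal_mul (by rw [hou]; positivity),
          ← ofReal_integral_eq_lintegral_ofReal h_integrable (.of_forall fun y => by positivity)]
        refine ENNReal.ofReal_le_ofReal ?_
        rw [integral_const_mul, relScore, hou, mul_assoc]
        have h_integrable' : Integrable (fun y => exp (-b * ‖x - a • y‖ ^ 2) *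
            (2 * ‖y‖ ^ 2 + 8 * b ^ 2 * ‖x - a • y‖ ^ 2)) μ :=
          (integrable_const_mul_iff hcpos.ne'.isUnit _).1 h_integrable
        refine mul_le_mul_of_nonneg_left (hle.trans ?_) hcpos.le
        refine integral_mono_of_nonneg (.of_forall fun y => by positivity) h_integrable'
          (.of_forall fun y => ?_)
        exact mul_le_mul_of_nonneg_left
          (norm_conditional_score_sq_le (by linarith) hbpos hab x y) (exp_pos _).le
    _ = ∫⁻ y, (∫⁻ x, ENNReal.ofReal (c * (exp (-b * ‖x - a • y‖ ^ 2) *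
        (2 * ‖y‖ ^ 2 + 8 * b ^ 2 * ‖x - a • y‖ ^ 2)))) ∂μ :=
        lintegral_lintegral_swap (by unfold Function.uncurry; fun_prop)
    _ ≤ ∫⁻ y, ENNReal.ofReal (2 * ‖y‖ ^ 2 + 16 * (d / v)) ∂μ := by
        refine lintegral_mono fun y => (lintegral_gaussian_mul_le hd hbpos
          (by positivity) (by positivity) (a • y)).trans_eq ?_
        congr 2
        rw [hb]
        field_simp
        norm_num
    _ = ENNReal.ofReal (∫ y, (2 * ‖y‖ ^ 2 + 16 * (d / v)) ∂μ) :=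
        (ofReal_integral_eq_lintegral_ofReal ((hμ.const_mul 2).fun_add (integrable_const _))
          (.of_forall fun y => by positivity)).symm
    _ = _ := by
        rw [integral_add (hμ.const_mul 2) (integrable_const _), integral_const_mul]
        simp

/-- Magic lemma I. There is a universal constant `C` such that for every
`d ≥ 1`, every probability measure `μ` on `ℝ^d` with `∫‖y‖² dμ ≤ M₂² < ∞`, and every `t > 0`,
the relative Fisher information satisfies `FI(μ_t ‖ γ_d) ≤ C (d/(1−e^{−2t}) + M₂²)`. -/
theorem statement_1 :
    ∃ C : ℝ, 0 < C ∧
      ∀ (d : ℕ), 1 ≤ d →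
        ∀ (μ : Measure (Euc d)), IsProbabilityMeasure μ →
          ∀ M₂ : ℝ, 0 ≤ M₂ →
            Integrable (fun y => ‖y‖ ^ 2) μ → (∫ y, ‖y‖ ^ 2 ∂μ) ≤ M₂ ^ 2 →
              ∀ t : ℝ, 0 < t →
                relFisher d μ t ≤ C * ((d : ℝ) / (1 - Real.exp (-2 * t)) + M₂ ^ 2) := by
  refine ⟨16, by norm_num, fun d hd μ _ M₂ _ hμ hM t ht => ?_⟩
  have hv : 0 < 1 - exp (-2 * t) := by
    have : exp (-2 * t) < 1 := exp_lt_one_iff.2 (by linarith)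
    linarith
  have hnonneg : 0 ≤ ∫ y, ‖y‖ ^ 2 ∂μ := integral_nonneg fun y => by positivity
  have h : relFisher d μ t ≤ 2 * (∫ y, ‖y‖ ^ 2 ∂μ) + 16 * (d / (1 - exp (-2 * t))) :=
    integral_le_of_lintegral_ofReal_le (fun x => sq_nonneg _) (by positivity)
      (lintegral_relScore_sq_le hd μ hμ ht)
  nlinarith
end
end

section
/- There is a universal constant C such that the following holds. Let μ be a probability measure on ℝ^d with finite second moment, let 0 < s < t, let X ∼ μ_s, let Z ∼ γ_d be independent of X, and set Y = e^{−(t−s)} X + √(1−e^{−2(t−s)}) Z (so that Y ∼ μ_t). Then E‖(∇log p_t(Y) + Y) − (∇log p_s(X) + X)‖² ≤ C·(FI(μ_s ‖ γ_d) − FI(μ_t ‖ γ_d)). -/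
open MeasureTheory Real
open scoped RealInnerProductSpace ENNReal Classical

noncomputable section

/-- The density of the centred Gaussian measure `N(0, v I_d)` on `ℝ^d`. -/
def gaussianKernel (d : ℕ) (v : ℝ) (z : Euc d) : ℝ :=
  (2 * π * v) ^ (-(d : ℝ) / 2) * Real.exp (-‖z‖ ^ 2 / (2 * v))

lemma gaussianKernel_pos {d : ℕ} {v : ℝ} (hv : 0 < v) (z : Euc d) :
    0 < gaussianKernel d v z := by
  unfold gaussianKernel; positivity

lemma gaussianKernel_le {d : ℕ} {v : ℝ} (hv : 0 < v) (z : Euc d) :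
    gaussianKernel d v z ≤ (2 * π * v) ^ (-(d : ℝ) / 2) := by
  unfold gaussianKernel
  refine mul_le_of_le_one_right (by positivity) (Real.exp_le_one_iff.2 ?_)
  rw [neg_div]
  exact neg_nonpos.2 (by positivity)

@[fun_prop]
lemma continuous_gaussianKernel (d : ℕ) (v : ℝ) : Continuous (gaussianKernel d v) := by
  unfold gaussianKernel; fun_prop

lemma gaussianKernel_neg {d : ℕ} (v : ℝ) (z : Euc d) :
    gaussianKernel d v (-z) = gaussianKernel d v z := by
  simp [gaussianKernel]

lemma integral_gaussianKernel {d : ℕ} {v : ℝ} (hv : 0 < v) :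
    ∫ z, gaussianKernel d v z = 1 := by
  unfold gaussianKernel
  rw [integral_const_mul]
  have h := GaussianFourier.integral_rexp_neg_mul_sq_norm (V := Euc d) (b := 1 / (2 * v))
    (by positivity)
  have h2 : ∀ z : Euc d, -‖z‖ ^ 2 / (2 * v) = -(1 / (2 * v)) * ‖z‖ ^ 2 := fun z => by ring
  simp_rw [h2, h]
  rw [finrank_euclideanSpace_fin, show π / (1 / (2 * v)) = 2 * π * v by field_simp,
    ← Real.rpow_add (by positivity)]
  simp [neg_div]

lemma integrable_gaussianKernel_s2 {d : ℕ} {v : ℝ} (hv : 0 < v) :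
    Integrable (gaussianKernel d v) :=
  Integrable.of_integral_ne_zero (by rw [integral_gaussianKernel hv]; exact one_ne_zero)

lemma norm_sq_mul_gaussianKernel_le {d : ℕ} {v : ℝ} (hv : 0 < v) (z : Euc d) :
    ‖z‖ ^ 2 * gaussianKernel d v z ≤
      4 * v * 2 ^ ((d : ℝ) / 2) * gaussianKernel d (2 * v) z := by
  have h1 : ‖z‖ ^ 2 / (4 * v) ≤ Real.exp (‖z‖ ^ 2 / (4 * v)) :=
    (le_add_of_nonneg_right zero_le_one).trans (Real.add_one_le_exp _)
  have h2 : ‖z‖ ^ 2 ≤ 4 * v * Real.exp (‖z‖ ^ 2 / (4 * v)) := by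
    rwa [div_le_iff₀' (by positivity)] at h1
  have h3 : (2 * π * (2 * v)) ^ (-(d : ℝ) / 2) =
      2 ^ (-(d : ℝ) / 2) * (2 * π * v) ^ (-(d : ℝ) / 2) := by
    rw [← Real.mul_rpow (by positivity) (by positivity)]; ring_nf
  have h4 : (2 : ℝ) ^ ((d : ℝ) / 2) * 2 ^ (-(d : ℝ) / 2) = 1 := by
    rw [← Real.rpow_add two_pos]; simp [neg_div]
  have h5 : Real.exp (‖z‖ ^ 2 / (4 * v)) * Real.exp (-‖z‖ ^ 2 / (2 * v)) =
      Real.exp (-‖z‖ ^ 2 / (2 * (2 * v))) := by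
    rw [← Real.exp_add]; congr 1; field_simp; ring
  calc ‖z‖ ^ 2 * gaussianKernel d v z
      ≤ 4 * v * Real.exp (‖z‖ ^ 2 / (4 * v)) * gaussianKernel d v z :=
        mul_le_mul_of_nonneg_right h2 (gaussianKernel_pos hv z).le
    _ = 4 * v * (2 * π * v) ^ (-(d : ℝ) / 2) *
          (Real.exp (‖z‖ ^ 2 / (4 * v)) * Real.exp (-‖z‖ ^ 2 / (2 * v))) := by
        unfold gaussianKernel; ring
    _ = 4 * v * (2 ^ ((d : ℝ) / 2) * 2 ^ (-(d : ℝ) / 2)) * (2 * π * v) ^ (-(d : ℝ) / 2) *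
          Real.exp (-‖z‖ ^ 2 / (2 * (2 * v))) := by rw [h4, h5, mul_one]
    _ = _ := by unfold gaussianKernel; rw [h3]; ring

lemma integrable_norm_sq_mul_gaussianKernel {d : ℕ} {v : ℝ} (hv : 0 < v) :
    Integrable fun z => ‖z‖ ^ 2 * gaussianKernel d v z := by
  refine ((integrable_gaussianKernel_s2 (d := d) (v := 2 * v) (by positivity)).const_mul
    (4 * v * 2 ^ ((d : ℝ) / 2))).mono' (by fun_prop) (ae_of_all _ fun z => ?_)
  rw [Real.norm_of_nonneg (mul_nonneg (sq_nonneg _) (gaussianKernel_pos hv z).le)]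
  exact norm_sq_mul_gaussianKernel_le hv z

lemma integrable_gaussianKernel_smul_s2 {d : ℕ} {v : ℝ} (hv : 0 < v) :
    Integrable fun z => gaussianKernel d v z • z := by
  refine ((integrable_gaussianKernel_s2 (d := d) hv).add
    (integrable_norm_sq_mul_gaussianKernel (d := d) hv)).mono' (by fun_prop)
    (ae_of_all _ fun z => ?_)
  have hG := (gaussianKernel_pos hv z).le
  rw [norm_smul, Real.norm_of_nonneg hG, Pi.add_apply]
  nlinarith [mul_nonneg hG (sq_nonneg (‖z‖ - 1)), mul_nonneg hG (sq_nonneg ‖z‖)]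

lemma integral_gaussianKernel_smul {d : ℕ} {v : ℝ} :
    ∫ z, gaussianKernel d v z • z = 0 := by
  have h := integral_neg_eq_self (fun z => gaussianKernel d v z • z) volume
  simp_rw [gaussianKernel_neg, smul_neg, integral_neg] at h
  have h2 : (2 : ℝ) • ∫ z, gaussianKernel d v z • z = 0 := by
    rw [two_smul]; nth_rewrite 1 [← h]; exact neg_add_cancel _
  exact (smul_eq_zero.1 h2).resolve_left two_ne_zero

lemma integral_gaussianKernel_sub_smul_affine {d : ℕ} {v : ℝ} (hv : 0 < v) (m q : Euc d)
    (c : ℝ) : ∫ x, gaussianKernel d v (x - m) • (c • x + q) = c • m + q := by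
  rw [← integral_add_right_eq_self _ m]
  have h : ∀ x : Euc d, gaussianKernel d v (x + m - m) • (c • (x + m) + q) =
      c • gaussianKernel d v x • x + gaussianKernel d v x • (c • m + q) := fun x => by
    rw [add_sub_cancel_right]; module
  simp_rw [h]
  rw [integral_add (by exact (integrable_gaussianKernel_smul_s2 hv).smul c)
    ((integrable_gaussianKernel_s2 hv).smul_const _), integral_smul, integral_gaussianKernel_smul,
    integral_smul_const, integral_gaussianKernel hv]
  simp

lemma gaussianKernel_mul {d : ℕ} {v w : ℝ} (hv : 0 < v) (hw : 0 < w) (a : ℝ) (u r : Euc d) :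
    gaussianKernel d v u * gaussianKernel d w (r - a • u) =
      gaussianKernel d (w + a ^ 2 * v) r *
        gaussianKernel d (v * w / (w + a ^ 2 * v)) (u - (a * v / (w + a ^ 2 * v)) • r) := by
  have hs : 0 < w + a ^ 2 * v := by positivity
  have h1 : (2 * π * v) ^ (-(d : ℝ) / 2) * (2 * π * w) ^ (-(d : ℝ) / 2) =
      (2 * π * (w + a ^ 2 * v)) ^ (-(d : ℝ) / 2) *
        (2 * π * (v * w / (w + a ^ 2 * v))) ^ (-(d : ℝ) / 2) := by
    rw [← Real.mul_rpow (by positivity) (by positivity),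
      ← Real.mul_rpow (by positivity) (by positivity)]
    congr 1; field_simp
  have h2 : -‖u‖ ^ 2 / (2 * v) + -‖r - a • u‖ ^ 2 / (2 * w) =
      -‖r‖ ^ 2 / (2 * (w + a ^ 2 * v)) +
        -‖u - (a * v / (w + a ^ 2 * v)) • r‖ ^ 2 / (2 * (v * w / (w + a ^ 2 * v))) := by
    rw [norm_sub_sq_real, norm_sub_sq_real, norm_smul, norm_smul, inner_smul_right,
      inner_smul_right, real_inner_comm, mul_pow, mul_pow, Real.norm_eq_abs, Real.norm_eq_abs,
      sq_abs, sq_abs]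
    field_simp
    ring
  unfold gaussianKernel
  calc _ = (2 * π * v) ^ (-(d : ℝ) / 2) * (2 * π * w) ^ (-(d : ℝ) / 2) *
        Real.exp (-‖u‖ ^ 2 / (2 * v) + -‖r - a • u‖ ^ 2 / (2 * w)) := by
        rw [Real.exp_add]; ring
    _ = _ := by rw [h1, h2, Real.exp_add]; ring

lemma map_stdGaussian {d : ℕ} {v : ℝ} (hv : 0 < v) (c : Euc d) :
    (stdGaussian d).map (fun z => c + Real.sqrt v • z) =
      volume.withDensity fun y => ENNReal.ofReal (gaussianKernel d v (y - c)) := by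
  have hsv : 0 < Real.sqrt v := Real.sqrt_pos.2 hv
  refine Measure.ext_of_lintegral _ fun φ hφ => ?_
  rw [lintegral_map hφ (by fun_prop), stdGaussian,
    lintegral_withDensity_eq_lintegral_mul _ (by fun_prop) (by fun_prop),
    lintegral_withDensity_eq_lintegral_mul _ (by fun_prop) hφ]
  set ψ : Euc d → ℝ≥0∞ := fun w => ENNReal.ofReal (gaussianKernel d v w) * φ (c + w) with hψ
  have hψm : Measurable ψ := by fun_prop
  have h0 : Real.sqrt v ^ d = v ^ ((d : ℝ) / 2) := by
    rw [Real.sqrt_eq_rpow, ← Real.rpow_natCast, ← Real.rpow_mul hv.le]; ring_nf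
  have h1 : ∀ z : Euc d, (2 * π) ^ (-(d : ℝ) / 2) * Real.exp (-‖z‖ ^ 2 / 2) =
      Real.sqrt v ^ d * gaussianKernel d v (Real.sqrt v • z) := fun z => by
    unfold gaussianKernel
    rw [norm_smul, mul_pow, Real.norm_of_nonneg hsv.le, Real.sq_sqrt hv.le,
      Real.mul_rpow (by positivity) hv.le, neg_div 2 (d : ℝ), Real.rpow_neg hv.le, h0]
    have : v ^ ((d : ℝ) / 2) ≠ 0 := by positivity
    field_simp
  have h2 : ∫⁻ z, ψ (Real.sqrt v • z) = ENNReal.ofReal ((Real.sqrt v ^ d)⁻¹) * ∫⁻ w, ψ w := by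
    rw [← lintegral_map hψm (by fun_prop), Measure.map_addHaar_smul _ hsv.ne',
      lintegral_smul_measure, finrank_euclideanSpace_fin, abs_of_pos (by positivity), smul_eq_mul]
  have h3 : ∀ z : Euc d, ENNReal.ofReal ((2 * π) ^ (-(d : ℝ) / 2) * Real.exp (-‖z‖ ^ 2 / 2)) *
      φ (c + Real.sqrt v • z) = ENNReal.ofReal (Real.sqrt v ^ d) * ψ (Real.sqrt v • z) :=
    fun z => by
    simp only [hψ, h1 z]
    rw [ENNReal.ofReal_mul (by positivity), mul_assoc]
  simp only [Pi.mul_apply]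
  rw [lintegral_congr h3, lintegral_const_mul _ (by fun_prop), h2, ← mul_assoc,
    ← ENNReal.ofReal_mul (by positivity), mul_inv_cancel₀ (by positivity), ENNReal.ofReal_one,
    one_mul, ← lintegral_sub_right_eq_self ψ c]
  simp [hψ]

instance isProbabilityMeasure_stdGaussian (d : ℕ) : IsProbabilityMeasure (stdGaussian d) := by
  constructor
  rw [stdGaussian, withDensity_apply _ MeasurableSet.univ, Measure.restrict_univ]
  have h := integral_gaussianKernel (d := d) one_pos
  rw [← ENNReal.ofReal_one, ← h, ofReal_integral_eq_lintegral_ofReal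
    (integrable_gaussianKernel_s2 one_pos) (ae_of_all _ fun z => (gaussianKernel_pos one_pos z).le)]
  simp [gaussianKernel]

/-- The density of the law of `b X + √v Z` for independent `X ∼ μ` and `Z ∼ N(0, I_d)`. -/
def gaussianMixture (d : ℕ) (μ : Measure (Euc d)) (b v : ℝ) (x : Euc d) : ℝ :=
  ∫ y, gaussianKernel d v (x - b • y) ∂μ

/-- The relative score at `x` of the Gaussian measure `N(b y, v I_d)`. -/
def gaussianScore (d : ℕ) (b v : ℝ) (y x : Euc d) : Euc d := x - v⁻¹ • (x - b • y)

/-- The relative score of a Gaussian mixture, multiplied by its density. -/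
def gaussianMixtureFlux (d : ℕ) (μ : Measure (Euc d)) (b v : ℝ) (x : Euc d) : Euc d :=
  ∫ y, gaussianKernel d v (x - b • y) • gaussianScore d b v y x ∂μ

@[fun_prop]
lemma continuous_gaussianScore (d : ℕ) (b v : ℝ) :
    Continuous fun p : Euc d × Euc d => gaussianScore d b v p.1 p.2 := by
  unfold gaussianScore; fun_prop

lemma norm_sq_gaussianScore_le {d : ℕ} (b v : ℝ) (y x : Euc d) :
    ‖gaussianScore d b v y x‖ ^ 2 ≤
      2 * (1 - v⁻¹) ^ 2 * ‖x - b • y‖ ^ 2 + 2 * b ^ 2 * ‖y‖ ^ 2 := by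
  have h : gaussianScore d b v y x = (1 - v⁻¹) • (x - b • y) + b • y := by
    unfold gaussianScore; module
  have h1 := norm_add_le ((1 - v⁻¹) • (x - b • y)) (b • y)
  rw [← h, norm_smul, norm_smul, Real.norm_eq_abs, Real.norm_eq_abs] at h1
  calc ‖gaussianScore d b v y x‖ ^ 2 ≤ (|1 - v⁻¹| * ‖x - b • y‖ + |b| * ‖y‖) ^ 2 := by gcongr
    _ ≤ 2 * (|1 - v⁻¹| ^ 2 * ‖x - b • y‖ ^ 2) + 2 * (|b| ^ 2 * ‖y‖ ^ 2) := by
      nlinarith [sq_nonneg (|1 - v⁻¹| * ‖x - b • y‖ - |b| * ‖y‖)]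
    _ = _ := by rw [sq_abs, sq_abs]; ring

lemma integrable_prod_mul_comp_sub {d : ℕ} {μ : Measure (Euc d)} [SFinite μ] {f g : Euc d → ℝ}
    (hg : Integrable g μ) (hf : Integrable f) (b : ℝ) :
    Integrable (fun p : Euc d × Euc d => g p.1 * f (p.2 - b • p.1)) (μ.prod volume) := by
  have mp : MeasurePreserving (fun p : Euc d × Euc d => (p.1, p.2 - b • p.1))
      (μ.prod volume) (μ.prod volume) :=
    (MeasurePreserving.id μ).skew_product (g := fun y x => x - b • y) (by fun_prop)
      (ae_of_all _ fun y => (measurePreserving_sub_right volume _).map_eq)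
  exact mp.integrable_comp_of_integrable (hg.mul_prod hf)

section Mixture

variable {d : ℕ} {μ : Measure (Euc d)} [IsProbabilityMeasure μ] {b v : ℝ}

lemma integrable_gaussianKernel_prod (hv : 0 < v) :
    Integrable (fun p : Euc d × Euc d => gaussianKernel d v (p.2 - b • p.1))
      (μ.prod volume) := by
  simpa using integrable_prod_mul_comp_sub (μ := μ) (integrable_const 1)
    (integrable_gaussianKernel_s2 hv) b

lemma integrable_gaussianKernel_mul_norm_sq_gaussianScore (hv : 0 < v)
    (hμ : Integrable (fun y => ‖y‖ ^ 2) μ) :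
    Integrable (fun p : Euc d × Euc d => gaussianKernel d v (p.2 - b • p.1) *
      ‖gaussianScore d b v p.1 p.2‖ ^ 2) (μ.prod volume) := by
  have h1 := integrable_prod_mul_comp_sub (μ := μ) (integrable_const 1)
    (integrable_norm_sq_mul_gaussianKernel hv) b
  have h2 := integrable_prod_mul_comp_sub hμ (integrable_gaussianKernel_s2 hv) b
  refine ((h1.const_mul (2 * (1 - v⁻¹) ^ 2)).add (h2.const_mul (2 * b ^ 2))).mono'
    (Continuous.aestronglyMeasurable (by fun_prop)) (ae_of_all _ fun p => ?_)
  have hG := (gaussianKernel_pos hv (p.2 - b • p.1)).le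
  rw [Real.norm_of_nonneg (by positivity)]
  refine (mul_le_mul_of_nonneg_left (norm_sq_gaussianScore_le b v p.1 p.2) hG).trans_eq ?_
  simp only [Pi.add_apply]; ring

lemma integrable_gaussianKernel_smul_gaussianScore (hv : 0 < v)
    (hμ : Integrable (fun y => ‖y‖ ^ 2) μ) :
    Integrable (fun p : Euc d × Euc d => gaussianKernel d v (p.2 - b • p.1) •
      gaussianScore d b v p.1 p.2) (μ.prod volume) := by
  refine ((integrable_gaussianKernel_prod (b := b) hv).add
    (integrable_gaussianKernel_mul_norm_sq_gaussianScore (b := b) hv hμ)).mono'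
    (Continuous.aestronglyMeasurable (by fun_prop)) (ae_of_all _ fun p => ?_)
  have hG := (gaussianKernel_pos hv (p.2 - b • p.1)).le
  rw [norm_smul, Real.norm_of_nonneg hG, Pi.add_apply, ← mul_one_add]
  refine mul_le_mul_of_nonneg_left ?_ hG
  nlinarith [sq_nonneg (‖gaussianScore d b v p.1 p.2‖ - 1),
    sq_nonneg ‖gaussianScore d b v p.1 p.2‖]

lemma integrable_gaussianKernel_comp (hv : 0 < v) (x : Euc d) :
    Integrable (fun y => gaussianKernel d v (x - b • y)) μ := by
  refine (integrable_const ((2 * π * v) ^ (-(d : ℝ) / 2))).mono'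
    (Continuous.aestronglyMeasurable (by fun_prop)) (ae_of_all _ fun y => ?_)
  rw [Real.norm_of_nonneg (gaussianKernel_pos hv _).le]
  exact gaussianKernel_le hv _

lemma gaussianMixture_pos (hv : 0 < v) (x : Euc d) : 0 < gaussianMixture d μ b v x := by
  refine (integral_pos_iff_support_of_nonneg (fun y => (gaussianKernel_pos hv _).le)
    (integrable_gaussianKernel_comp hv x)).2 ?_
  have : Function.support (fun y => gaussianKernel d v (x - b • y)) = Set.univ :=
    Set.eq_univ_of_forall fun y => (gaussianKernel_pos hv _).ne'
  simp [this]

lemma measurable_gaussianMixture : Measurable (gaussianMixture d μ b v) := by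
  have h : StronglyMeasurable (fun p : Euc d × Euc d => gaussianKernel d v (p.1 - b • p.2)) :=
    Continuous.stronglyMeasurable (by fun_prop)
  exact h.integral_prod_right.measurable

lemma stronglyMeasurable_gaussianMixtureFlux :
    StronglyMeasurable (gaussianMixtureFlux d μ b v) := by
  have h : StronglyMeasurable (fun p : Euc d × Euc d =>
      gaussianKernel d v (p.1 - b • p.2) • gaussianScore d b v p.2 p.1) := by
    unfold gaussianScore
    exact Continuous.stronglyMeasurable (by fun_prop)
  exact h.integral_prod_right

lemma integrable_gaussianMixture (hv : 0 < v) : Integrable (gaussianMixture d μ b v) :=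
  (integrable_gaussianKernel_prod hv).integral_prod_right

lemma norm_mul_gaussianKernel_le (hv : 0 < v) (z : Euc d) :
    ‖z‖ * gaussianKernel d v z ≤ (1 + 2 * v) * (2 * π * v) ^ (-(d : ℝ) / 2) := by
  have h1 := Real.add_one_le_exp (‖z‖ ^ 2 / (2 * v))
  have h2 : ‖z‖ ≤ (1 + 2 * v) * (‖z‖ ^ 2 / (2 * v) + 1) := by
    have : (1 + 2 * v) * (‖z‖ ^ 2 / (2 * v) + 1) =
        ‖z‖ ^ 2 / (2 * v) + ‖z‖ ^ 2 + 1 + 2 * v := by field_simp; ring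
    have h3 : 0 ≤ ‖z‖ ^ 2 / (2 * v) := by positivity
    nlinarith [sq_nonneg (‖z‖ - 1), sq_nonneg ‖z‖]
  have h4 : Real.exp (‖z‖ ^ 2 / (2 * v)) * Real.exp (-‖z‖ ^ 2 / (2 * v)) = 1 := by
    rw [← Real.exp_add, neg_div, add_neg_cancel, Real.exp_zero]
  calc ‖z‖ * gaussianKernel d v z
      ≤ (1 + 2 * v) * Real.exp (‖z‖ ^ 2 / (2 * v)) * gaussianKernel d v z := by
        refine mul_le_mul_of_nonneg_right (h2.trans ?_) (gaussianKernel_pos hv z).le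
        gcongr
    _ = (1 + 2 * v) * (2 * π * v) ^ (-(d : ℝ) / 2) *
        (Real.exp (‖z‖ ^ 2 / (2 * v)) * Real.exp (-‖z‖ ^ 2 / (2 * v))) := by
        unfold gaussianKernel; ring
    _ = _ := by rw [h4, mul_one]

lemma hasFDerivAt_gaussianKernel_sub (v : ℝ) (c x : Euc d) :
    HasFDerivAt (fun x => gaussianKernel d v (x - c))
      (innerSL ℝ (-(gaussianKernel d v (x - c) • v⁻¹ • (x - c)))) x := by
  have h := ((((((hasFDerivAt_id x).sub_const c).norm_sq).neg).mul_const
    (2 * v)⁻¹).exp).const_mul ((2 * π * v) ^ (-(d : ℝ) / 2))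
  refine (h.congr_of_eventuallyEq (.of_eq ?_)).congr_fderiv ?_
  · funext z; simp [gaussianKernel, div_eq_mul_inv]
  · ext w
    simp [gaussianKernel, div_eq_mul_inv]
    ring

lemma integrable_gaussianKernel_smul_sub (hv : 0 < v) (x : Euc d) :
    Integrable (fun y => gaussianKernel d v (x - b • y) • v⁻¹ • (x - b • y)) μ := by
  refine (integrable_const (v⁻¹ * ((1 + 2 * v) * (2 * π * v) ^ (-(d : ℝ) / 2)))).mono'
    (Continuous.aestronglyMeasurable (by fun_prop)) (ae_of_all _ fun y => ?_)
  rw [norm_smul, norm_smul, Real.norm_of_nonneg (gaussianKernel_pos hv _).le,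
    Real.norm_of_nonneg (by positivity), mul_left_comm, mul_comm (gaussianKernel _ _ _)]
  exact mul_le_mul_of_nonneg_left (norm_mul_gaussianKernel_le hv _) (by positivity)

lemma gaussianMixtureFlux_eq (hv : 0 < v) (x : Euc d) :
    gaussianMixtureFlux d μ b v x = gaussianMixture d μ b v x • x -
      ∫ y, gaussianKernel d v (x - b • y) • v⁻¹ • (x - b • y) ∂μ := by
  unfold gaussianMixtureFlux gaussianMixture gaussianScore
  simp_rw [smul_sub (gaussianKernel d v _)]
  rw [integral_sub ((integrable_gaussianKernel_comp hv x).smul_const x)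
    (integrable_gaussianKernel_smul_sub hv x), integral_smul_const]

lemma hasGradientAt_gaussianMixture (hv : 0 < v) (x : Euc d) :
    HasGradientAt (gaussianMixture d μ b v)
      (-∫ y, gaussianKernel d v (x - b • y) • v⁻¹ • (x - b • y) ∂μ) x := by
  have h := hasFDerivAt_integral_of_dominated_of_fderiv_le (𝕜 := ℝ) (μ := μ) (x₀ := x)
    (s := Set.univ) (F := fun x y => gaussianKernel d v (x - b • y))
    (F' := fun x y => innerSL ℝ (-(gaussianKernel d v (x - b • y) • v⁻¹ • (x - b • y))))
    (bound := fun _ => v⁻¹ * ((1 + 2 * v) * (2 * π * v) ^ (-(d : ℝ) / 2)))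
    Filter.univ_mem
    (Filter.Eventually.of_forall fun x => Continuous.aestronglyMeasurable (by fun_prop))
    (integrable_gaussianKernel_comp hv x) (Continuous.aestronglyMeasurable (by fun_prop))
    (ae_of_all _ fun y x _ => ?_) (integrable_const _)
    (ae_of_all _ fun y x _ => hasFDerivAt_gaussianKernel_sub v (b • y) x)
  · rw [hasGradientAt_iff_hasFDerivAt]
    refine h.congr_fderiv ?_
    have h2 := (InnerProductSpace.toDual ℝ (Euc d)).toContinuousLinearEquiv.integral_comp_comm
      (μ := μ) (fun y => -(gaussianKernel d v (x - b • y) • v⁻¹ • (x - b • y)))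
    rw [integral_neg] at h2
    exact h2
  · rw [innerSL_apply_norm, norm_neg, norm_smul, norm_smul,
      Real.norm_of_nonneg (gaussianKernel_pos hv _).le,
      Real.norm_of_nonneg (by positivity), mul_left_comm, mul_comm (gaussianKernel _ _ _)]
    exact mul_le_mul_of_nonneg_left (norm_mul_gaussianKernel_le hv _) (by positivity)

lemma gradient_log_gaussianMixture_add_self (hv : 0 < v) (x : Euc d) :
    gradient (fun z => Real.log (gaussianMixture d μ b v z)) x + x =
      (gaussianMixture d μ b v x)⁻¹ • gaussianMixtureFlux d μ b v x := by
  have hp := gaussianMixture_pos (μ := μ) (b := b) hv x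
  have h : HasGradientAt (fun z => Real.log (gaussianMixture d μ b v z))
      ((gaussianMixture d μ b v x)⁻¹ •
        -∫ y, gaussianKernel d v (x - b • y) • v⁻¹ • (x - b • y) ∂μ) x := by
    have := (hasGradientAt_gaussianMixture (μ := μ) (b := b) hv x).hasFDerivAt.log hp.ne'
    rw [hasGradientAt_iff_hasFDerivAt, map_smul]
    exact this
  rw [h.gradient, gaussianMixtureFlux_eq hv, smul_sub, inv_smul_smul₀ hp.ne']
  module

end Mixture

lemma norm_sq_average_mul_le {α E : Type*} [MeasurableSpace α] [NormedAddCommGroup E]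
    [InnerProductSpace ℝ E] [CompleteSpace E] {μ : Measure α} {F : α → ℝ} {σ : α → E}
    (hF0 : ∀ y, 0 ≤ F y) (hpos : 0 < ∫ y, F y ∂μ) (hF : Integrable F μ)
    (hFσ : Integrable (fun y => F y • σ y) μ) (hFσ2 : Integrable (fun y => F y * ‖σ y‖ ^ 2) μ) :
    ‖(∫ y, F y ∂μ)⁻¹ • ∫ y, F y • σ y ∂μ‖ ^ 2 * ∫ y, F y ∂μ ≤ ∫ y, F y * ‖σ y‖ ^ 2 ∂μ := by
  set P := ∫ y, F y ∂μ with hP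
  set W := ∫ y, F y • σ y ∂μ with hW
  set R := P⁻¹ • W with hR
  have h0 : 0 ≤ ∫ y, F y * ‖σ y - R‖ ^ 2 ∂μ :=
    integral_nonneg fun y => mul_nonneg (hF0 y) (sq_nonneg _)
  have h1 : ∀ y, F y * ‖σ y - R‖ ^ 2 =
      F y * ‖σ y‖ ^ 2 - 2 * ⟪R, F y • σ y⟫ + F y * ‖R‖ ^ 2 := fun y => by
    rw [norm_sub_sq_real, real_inner_smul_right R (σ y) (F y), real_inner_comm R (σ y)]; ring
  have hi : Integrable (fun y => 2 * ⟪R, F y • σ y⟫) μ := (hFσ.const_inner R).const_mul 2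
  have hs : Integrable (fun y => F y * ‖σ y‖ ^ 2 - 2 * ⟪R, F y • σ y⟫) μ := hFσ2.sub hi
  simp_rw [h1] at h0
  rw [integral_add hs (hF.mul_const _), integral_sub hFσ2 hi, integral_const_mul,
    integral_mul_const, integral_inner hFσ, ← hW, ← hP] at h0
  have h2 : W = P • R := by rw [hR, smul_inv_smul₀ hpos.ne']
  rw [h2, real_inner_smul_right R R P, real_inner_self_eq_norm_sq] at h0
  linarith

lemma integrable_norm_sq_score {d : ℕ} {μ : Measure (Euc d)} [IsProbabilityMeasure μ] {b v : ℝ}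
    (hv : 0 < v) (hμ : Integrable (fun y => ‖y‖ ^ 2) μ) :
    Integrable fun x => ‖(gaussianMixture d μ b v x)⁻¹ • gaussianMixtureFlux d μ b v x‖ ^ 2 *
      gaussianMixture d μ b v x := by
  have hA := integrable_gaussianKernel_mul_norm_sq_gaussianScore (b := b) hv hμ
  refine hA.integral_prod_right.mono' ?_ ?_
  · exact ((((measurable_gaussianMixture.inv).stronglyMeasurable.smul
      stronglyMeasurable_gaussianMixtureFlux).norm.pow 2).mul
      measurable_gaussianMixture.stronglyMeasurable).aestronglyMeasurable
  · filter_upwards [hA.prod_left_ae,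
      (integrable_gaussianKernel_smul_gaussianScore (b := b) hv hμ).prod_left_ae] with x h1 h2
    have hp := gaussianMixture_pos (μ := μ) (b := b) hv x
    rw [Real.norm_of_nonneg (by positivity)]
    exact norm_sq_average_mul_le (fun y => (gaussianKernel_pos hv _).le) hp
      (integrable_gaussianKernel_comp hv x) h2 h1

/-- The joint density of `X` and `a X + √w Z`, for `X` distributed as a Gaussian mixture and `Z`
an independent standard Gaussian vector. -/
def mixtureJoint (d : ℕ) (μ : Measure (Euc d)) (b v a w : ℝ) (p : Euc d × Euc d) : ℝ :=
  gaussianMixture d μ b v p.1 * gaussianKernel d w (p.2 - a • p.1)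

section Joint

variable {d : ℕ} {μ : Measure (Euc d)} [IsProbabilityMeasure μ] {b v a w : ℝ}

lemma mixtureJoint_nonneg (hv : 0 < v) (hw : 0 < w) (p : Euc d × Euc d) :
    0 ≤ mixtureJoint d μ b v a w p :=
  mul_nonneg (gaussianMixture_pos hv _).le (gaussianKernel_pos hw _).le

@[fun_prop]
lemma measurable_mixtureJoint : Measurable (mixtureJoint d μ b v a w) :=
  (measurable_gaussianMixture.comp measurable_fst).mul
    (by fun_prop : Continuous fun p : Euc d × Euc d =>
      gaussianKernel d w (p.2 - a • p.1)).measurable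

lemma gaussianKernel_mul_comp (hv : 0 < v) (hw : 0 < w) (x₀ x y : Euc d) :
    gaussianKernel d v (x - b • x₀) * gaussianKernel d w (y - a • x) =
      gaussianKernel d (w + a ^ 2 * v) (y - (a * b) • x₀) *
        gaussianKernel d (v * w / (w + a ^ 2 * v))
          (x - (b • x₀ + (a * v / (w + a ^ 2 * v)) • (y - (a * b) • x₀))) := by
  have h := gaussianKernel_mul hv hw a (x - b • x₀) (y - (a * b) • x₀)
  convert h using 3 <;> module

lemma integral_gaussianKernel_mul_comp (hv : 0 < v) (hw : 0 < w) (x₀ y : Euc d) :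
    ∫ x, gaussianKernel d v (x - b • x₀) * gaussianKernel d w (y - a • x) =
      gaussianKernel d (w + a ^ 2 * v) (y - (a * b) • x₀) := by
  simp_rw [gaussianKernel_mul_comp hv hw]
  rw [integral_const_mul, integral_sub_right_eq_self (gaussianKernel d _),
    integral_gaussianKernel (by positivity), mul_one]

lemma integral_gaussianKernel_mul_comp_smul_gaussianScore (hv : 0 < v) (hw : 0 < w) (ha : 0 < a)
    (hwa : w = 1 - a ^ 2) (x₀ y : Euc d) :
    ∫ x, (gaussianKernel d v (x - b • x₀) * gaussianKernel d w (y - a • x)) •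
        gaussianScore d b v x₀ x =
      a⁻¹ • gaussianKernel d (w + a ^ 2 * v) (y - (a * b) • x₀) •
        gaussianScore d (a * b) (w + a ^ 2 * v) x₀ y := by
  have hs : 0 < w + a ^ 2 * v := by positivity
  have h1 : ∀ x : Euc d, gaussianScore d b v x₀ x = (1 - v⁻¹) • x + (v⁻¹ * b) • x₀ := fun x => by
    unfold gaussianScore; module
  simp_rw [gaussianKernel_mul_comp hv hw, h1, mul_smul (gaussianKernel d (w + a ^ 2 * v) _)]
  rw [integral_smul, integral_gaussianKernel_sub_smul_affine (by positivity), smul_comm a⁻¹]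
  congr 1
  unfold gaussianScore
  have e1 : (1 - v⁻¹) * (a * v / (w + a ^ 2 * v)) = a⁻¹ * (1 - (w + a ^ 2 * v)⁻¹) := by
    field_simp
    rw [hwa]; ring
  have e2 : (1 - v⁻¹) * b - (1 - v⁻¹) * (a * v / (w + a ^ 2 * v)) * (a * b) + v⁻¹ * b =
      a⁻¹ * ((w + a ^ 2 * v)⁻¹ * (a * b)) := by
    rw [e1]; field_simp; rw [hwa]; ring
  calc _ = ((1 - v⁻¹) * (a * v / (w + a ^ 2 * v))) • y +
        ((1 - v⁻¹) * b - (1 - v⁻¹) * (a * v / (w + a ^ 2 * v)) * (a * b) + v⁻¹ * b) • x₀ := by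
        module
    _ = _ := by rw [e2, e1]; module

lemma integral_mixtureJoint_left (hv : 0 < v) (hw : 0 < w) (y : Euc d) :
    ∫ x, mixtureJoint d μ b v a w (x, y) = gaussianMixture d μ (a * b) (w + a ^ 2 * v) y := by
  have hi : Integrable (fun p : Euc d × Euc d => gaussianKernel d v (p.2 - b • p.1) *
      gaussianKernel d w (y - a • p.2)) (μ.prod volume) := by
    refine (integrable_gaussianKernel_prod hv).mul_bdd (c := (2 * π * w) ^ (-(d : ℝ) / 2))
      (Continuous.aestronglyMeasurable (by fun_prop)) (ae_of_all _ fun p => ?_)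
    rw [Real.norm_of_nonneg (gaussianKernel_pos hw _).le]
    exact gaussianKernel_le hw _
  simp only [mixtureJoint, gaussianMixture]
  simp_rw [← integral_mul_const]
  rw [← integral_integral_swap hi]
  simp_rw [integral_gaussianKernel_mul_comp hv hw]

lemma integral_gaussianKernel_smul_gaussianMixtureFlux (hv : 0 < v) (hw : 0 < w) (ha : 0 < a)
    (hwa : w = 1 - a ^ 2) (hμ : Integrable (fun y => ‖y‖ ^ 2) μ)
    (y : Euc d) :
    ∫ x, gaussianKernel d w (y - a • x) • gaussianMixtureFlux d μ b v x =
      a⁻¹ • gaussianMixtureFlux d μ (a * b) (w + a ^ 2 * v) y := by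
  have hi : Integrable (fun p : Euc d × Euc d => (gaussianKernel d v (p.2 - b • p.1) *
      gaussianKernel d w (y - a • p.2)) • gaussianScore d b v p.1 p.2) (μ.prod volume) := by
    simp_rw [mul_comm (gaussianKernel d v _), mul_smul]
    refine (integrable_gaussianKernel_smul_gaussianScore hv hμ).bdd_smul
      (φ := fun p : Euc d × Euc d => gaussianKernel d w (y - a • p.2))
      ((2 * π * w) ^ (-(d : ℝ) / 2)) (Continuous.aestronglyMeasurable (by fun_prop))
      (ae_of_all _ fun p => ?_)
    rw [Real.norm_of_nonneg (gaussianKernel_pos hw _).le]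
    exact gaussianKernel_le hw _
  unfold gaussianMixtureFlux
  simp_rw [← integral_smul (gaussianKernel d w _), ← mul_smul, mul_comm (gaussianKernel d w _)]
  rw [← integral_integral_swap hi, ← integral_smul]
  simp_rw [integral_gaussianKernel_mul_comp_smul_gaussianScore hv hw ha hwa]

lemma integrable_mixtureJoint_left (hv : 0 < v) (hw : 0 < w) (y : Euc d) :
    Integrable fun x => mixtureJoint d μ b v a w (x, y) := by
  refine (integrable_gaussianMixture hv).mul_bdd (c := (2 * π * w) ^ (-(d : ℝ) / 2))
    (Continuous.aestronglyMeasurable (by fun_prop)) (ae_of_all _ fun p => ?_)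
  rw [Real.norm_of_nonneg (gaussianKernel_pos hw _).le]
  exact gaussianKernel_le hw _

lemma integrable_gaussianKernel_smul_gaussianMixtureFlux (hv : 0 < v) (hw : 0 < w)
    (hμ : Integrable (fun y => ‖y‖ ^ 2) μ) (y : Euc d) :
    Integrable fun x => gaussianKernel d w (y - a • x) • gaussianMixtureFlux d μ b v x := by
  refine (integrable_gaussianKernel_smul_gaussianScore hv hμ).integral_prod_right.bdd_smul
    (φ := fun x => gaussianKernel d w (y - a • x)) ((2 * π * w) ^ (-(d : ℝ) / 2))
    (Continuous.aestronglyMeasurable (by fun_prop)) (ae_of_all _ fun x => ?_)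
  rw [Real.norm_of_nonneg (gaussianKernel_pos hw _).le]
  exact gaussianKernel_le hw _

/-- The measure whose density is a Gaussian mixture. -/
def mixtureMeasure (d : ℕ) (μ : Measure (Euc d)) (b v : ℝ) : Measure (Euc d) :=
  volume.withDensity fun x => ENNReal.ofReal (gaussianMixture d μ b v x)

instance (d : ℕ) (μ : Measure (Euc d)) (b v : ℝ) : SFinite (mixtureMeasure d μ b v) := by
  unfold mixtureMeasure; infer_instance

/-- The relative score of a Gaussian mixture. -/
def mixtureScore (d : ℕ) (μ : Measure (Euc d)) (b v : ℝ) (x : Euc d) : Euc d :=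
  (gaussianMixture d μ b v x)⁻¹ • gaussianMixtureFlux d μ b v x

lemma stronglyMeasurable_mixtureScore : StronglyMeasurable (mixtureScore d μ b v) :=
  measurable_gaussianMixture.inv.stronglyMeasurable.smul stronglyMeasurable_gaussianMixtureFlux

lemma integral_mixtureMeasure (hv : 0 < v) (f : Euc d → ℝ) :
    ∫ x, f x ∂mixtureMeasure d μ b v = ∫ x, gaussianMixture d μ b v x * f x := by
  rw [mixtureMeasure, integral_withDensity_eq_integral_toReal_smul
    measurable_gaussianMixture.ennreal_ofReal (ae_of_all _ fun _ => ENNReal.ofReal_lt_top)]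
  simp_rw [ENNReal.toReal_ofReal (gaussianMixture_pos hv _).le, smul_eq_mul]

lemma integrable_norm_sq_mixtureScore (hv : 0 < v) (hμ : Integrable (fun y => ‖y‖ ^ 2) μ) :
    Integrable (fun x => ‖mixtureScore d μ b v x‖ ^ 2) (mixtureMeasure d μ b v) := by
  rw [mixtureMeasure, integrable_withDensity_iff_integrable_smul'
    measurable_gaussianMixture.ennreal_ofReal (ae_of_all _ fun _ => ENNReal.ofReal_lt_top)]
  simp_rw [ENNReal.toReal_ofReal (gaussianMixture_pos hv _).le, smul_eq_mul]
  exact (integrable_norm_sq_score hv hμ).congr (ae_of_all _ fun x => mul_comm _ _)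

lemma map_prod_stdGaussian (hv : 0 < v) (hw : 0 < w) :
    ((mixtureMeasure d μ b v).prod (stdGaussian d)).map
        (fun p => (p.1, a • p.1 + Real.sqrt w • p.2)) =
      (volume.prod volume).withDensity fun p => ENNReal.ofReal (mixtureJoint d μ b v a w p) := by
  refine Measure.ext_of_lintegral _ fun φ hφ => ?_
  rw [lintegral_map hφ (by fun_prop), lintegral_prod _ (by fun_prop), mixtureMeasure,
    lintegral_withDensity_eq_lintegral_mul_non_measurable _
      measurable_gaussianMixture.ennreal_ofReal (ae_of_all _ fun _ => ENNReal.ofReal_lt_top),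
    lintegral_withDensity_eq_lintegral_mul _ (by fun_prop) hφ,
    lintegral_prod _ (by fun_prop)]
  refine lintegral_congr fun x => ?_
  have h : ∫⁻ z, φ (x, a • x + Real.sqrt w • z) ∂stdGaussian d =
      ∫⁻ y, ENNReal.ofReal (gaussianKernel d w (y - a • x)) * φ (x, y) := by
    rw [← lintegral_map (f := fun y => φ (x, y)) (by fun_prop) (by fun_prop),
      map_stdGaussian hw, lintegral_withDensity_eq_lintegral_mul _ (by fun_prop) (by fun_prop)]
    rfl
  simp only [Pi.mul_apply]
  rw [h, ← lintegral_const_mul _ (by fun_prop)]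
  refine lintegral_congr fun y => ?_
  rw [mixtureJoint, ENNReal.ofReal_mul (gaussianMixture_pos hv _).le, mul_assoc]

lemma map_snd_withDensity_mixtureJoint (hv : 0 < v) (hw : 0 < w) :
    ((volume.prod volume).withDensity fun p =>
        ENNReal.ofReal (mixtureJoint d μ b v a w p)).map Prod.snd =
      mixtureMeasure d μ (a * b) (w + a ^ 2 * v) := by
  refine Measure.ext_of_lintegral _ fun φ hφ => ?_
  rw [lintegral_map hφ (by fun_prop), mixtureMeasure,
    lintegral_withDensity_eq_lintegral_mul _ (by fun_prop) (by fun_prop),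
    lintegral_withDensity_eq_lintegral_mul _ measurable_gaussianMixture.ennreal_ofReal hφ,
    lintegral_prod_symm _ (by fun_prop)]
  refine lintegral_congr fun y => ?_
  simp only [Pi.mul_apply]
  rw [lintegral_mul_const _ (by fun_prop), ← integral_mixtureJoint_left hv hw,
    ofReal_integral_eq_lintegral_ofReal (integrable_mixtureJoint_left hv hw y)
      (ae_of_all _ fun x => mixtureJoint_nonneg hv hw _)]

lemma map_add_prod_stdGaussian (hv : 0 < v) (hw : 0 < w) :
    ((mixtureMeasure d μ b v).prod (stdGaussian d)).map
        (fun p => a • p.1 + Real.sqrt w • p.2) =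
      mixtureMeasure d μ (a * b) (w + a ^ 2 * v) := by
  rw [← map_snd_withDensity_mixtureJoint hv hw, ← map_prod_stdGaussian hv hw,
    Measure.map_map (by fun_prop) (by fun_prop)]
  rfl

lemma integrable_inner_of_norm_sq {Ω E : Type*} [MeasurableSpace Ω] {ν : Measure Ω}
    [NormedAddCommGroup E] [InnerProductSpace ℝ E] {f g : Ω → E}
    (hf : AEStronglyMeasurable f ν) (hg : AEStronglyMeasurable g ν)
    (hf2 : Integrable (fun p => ‖f p‖ ^ 2) ν) (hg2 : Integrable (fun p => ‖g p‖ ^ 2) ν) :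
    Integrable (fun p => ⟪f p, g p⟫) ν := by
  refine (hf2.add hg2).mono' (hf.inner hg) (ae_of_all _ fun p => ?_)
  refine (norm_inner_le_norm _ _).trans ?_
  simp only [Pi.add_apply]
  nlinarith [sq_nonneg (‖f p‖ - ‖g p‖), sq_nonneg ‖f p‖, sq_nonneg ‖g p‖]

/-- The relative score of the evolved mixture is, up to the factor `a`, the conditional expectation
of the relative score of the initial one; tested against the evolved score. -/
lemma integral_inner_mixtureScore (hv : 0 < v) (hw : 0 < w) (ha : 0 < a)
    (hwa : w = 1 - a ^ 2)
    (hint : Integrable (fun p : Euc d × Euc d =>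
      ⟪mixtureScore d μ (a * b) (w + a ^ 2 * v) (a • p.1 + Real.sqrt w • p.2),
        mixtureScore d μ b v p.1⟫) ((mixtureMeasure d μ b v).prod (stdGaussian d)))
    (hμ : Integrable (fun y => ‖y‖ ^ 2) μ) :
    ∫ p : Euc d × Euc d,
        ⟪mixtureScore d μ (a * b) (w + a ^ 2 * v) (a • p.1 + Real.sqrt w • p.2),
          mixtureScore d μ b v p.1⟫ ∂((mixtureMeasure d μ b v).prod (stdGaussian d)) =
      a⁻¹ * ∫ y, ‖mixtureScore d μ (a * b) (w + a ^ 2 * v) y‖ ^ 2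
        ∂mixtureMeasure d μ (a * b) (w + a ^ 2 * v) := by
  have hs : 0 < w + a ^ 2 * v := by positivity
  set B := mixtureScore d μ (a * b) (w + a ^ 2 * v) with hB
  set A := mixtureScore d μ b v with hA
  have hBm : StronglyMeasurable B := stronglyMeasurable_mixtureScore
  have hAm : StronglyMeasurable A := stronglyMeasurable_mixtureScore
  have hfm : StronglyMeasurable fun q : Euc d × Euc d => ⟪B q.2, A q.1⟫ :=
    (hBm.comp_measurable measurable_snd).inner (hAm.comp_measurable measurable_fst)
  have hT : Measurable fun p : Euc d × Euc d => (p.1, a • p.1 + Real.sqrt w • p.2) := by fun_prop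
  have hk : Measurable fun p => ENNReal.ofReal (mixtureJoint d μ b v a w p) := by fun_prop
  have hJ : Integrable (fun q : Euc d × Euc d => ⟪B q.2, A q.1⟫)
      ((volume.prod volume).withDensity
        fun p => ENNReal.ofReal (mixtureJoint d μ b v a w p)) := by
    rw [← map_prod_stdGaussian hv hw,
      integrable_map_measure hfm.aestronglyMeasurable hT.aemeasurable]
    exact hint
  rw [integrable_withDensity_iff_integrable_smul' hk
    (ae_of_all _ fun _ => ENNReal.ofReal_lt_top)] at hJ
  have h := integral_map (μ := (mixtureMeasure d μ b v).prod (stdGaussian d)) hT.aemeasurable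
    (f := fun q : Euc d × Euc d => ⟪B q.2, A q.1⟫) hfm.aestronglyMeasurable
  rw [← h, map_prod_stdGaussian hv hw, integral_withDensity_eq_integral_toReal_smul hk
    (ae_of_all _ fun _ => ENNReal.ofReal_lt_top), integral_prod_symm _ hJ,
    integral_mixtureMeasure hs, ← integral_const_mul]
  refine integral_congr_ae (ae_of_all _ fun y => ?_)
  have h1 : ∀ x, (ENNReal.ofReal (mixtureJoint d μ b v a w (x, y))).toReal • ⟪B y, A x⟫ =
      ⟪B y, gaussianKernel d w (y - a • x) • gaussianMixtureFlux d μ b v x⟫ := fun x => by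
    have hp := gaussianMixture_pos (μ := μ) (b := b) hv x
    rw [ENNReal.toReal_ofReal (mixtureJoint_nonneg hv hw _), hA, mixtureScore, mixtureJoint,
      inner_smul_right, inner_smul_right, smul_eq_mul]
    field_simp
  simp_rw [h1]
  rw [integral_inner (integrable_gaussianKernel_smul_gaussianMixtureFlux hv hw hμ y),
    integral_gaussianKernel_smul_gaussianMixtureFlux hv hw ha hwa hμ]
  have hp := gaussianMixture_pos (μ := μ) (b := a * b) hs y
  have h2 : gaussianMixtureFlux d μ (a * b) (w + a ^ 2 * v) y =
      gaussianMixture d μ (a * b) (w + a ^ 2 * v) y • B y := by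
    rw [hB, mixtureScore, smul_inv_smul₀ hp.ne']
  rw [h2, inner_smul_right, inner_smul_right, real_inner_self_eq_norm_sq]

lemma integral_norm_sq_mixtureScore_sub_le (hv : 0 < v) (hw : 0 < w) (ha : 0 < a)
    (hwa : w = 1 - a ^ 2) (hμ : Integrable (fun y => ‖y‖ ^ 2) μ) :
    ∫ p : Euc d × Euc d,
        ‖mixtureScore d μ (a * b) (w + a ^ 2 * v) (a • p.1 + Real.sqrt w • p.2) -
          mixtureScore d μ b v p.1‖ ^ 2 ∂((mixtureMeasure d μ b v).prod (stdGaussian d)) ≤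
      ∫ x, ‖mixtureScore d μ b v x‖ ^ 2 ∂mixtureMeasure d μ b v -
        ∫ y, ‖mixtureScore d μ (a * b) (w + a ^ 2 * v) y‖ ^ 2
          ∂mixtureMeasure d μ (a * b) (w + a ^ 2 * v) := by
  have hs : 0 < w + a ^ 2 * v := by positivity
  set ρ := (mixtureMeasure d μ b v).prod (stdGaussian d) with hρ
  set B := mixtureScore d μ (a * b) (w + a ^ 2 * v) with hB
  set A := mixtureScore d μ b v with hA
  have hBm : StronglyMeasurable B := stronglyMeasurable_mixtureScore
  have hAm : StronglyMeasurable A := stronglyMeasurable_mixtureScore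
  have hY : Measurable fun p : Euc d × Euc d => a • p.1 + Real.sqrt w • p.2 := by fun_prop
  have hX : ρ.map Prod.fst = mixtureMeasure d μ b v := measurePreserving_fst.map_eq
  have hYm : ρ.map (fun p => a • p.1 + Real.sqrt w • p.2) =
      mixtureMeasure d μ (a * b) (w + a ^ 2 * v) := map_add_prod_stdGaussian hv hw
  have hA2 : Integrable (fun p : Euc d × Euc d => ‖A p.1‖ ^ 2) ρ := by
    have h := integrable_norm_sq_mixtureScore (b := b) hv hμ
    rw [← hX] at h
    exact h.comp_measurable measurable_fst
  have hB2 : Integrable (fun p : Euc d × Euc d => ‖B (a • p.1 + Real.sqrt w • p.2)‖ ^ 2) ρ := by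
    have h := integrable_norm_sq_mixtureScore (b := a * b) hs hμ
    rw [← hYm] at h
    exact h.comp_measurable hY
  have hAi : ∫ p, ‖A p.1‖ ^ 2 ∂ρ = ∫ x, ‖A x‖ ^ 2 ∂mixtureMeasure d μ b v := by
    rw [← hX]
    exact (integral_map measurable_fst.aemeasurable (hAm.norm.pow 2).aestronglyMeasurable).symm
  have hBi : ∫ p, ‖B (a • p.1 + Real.sqrt w • p.2)‖ ^ 2 ∂ρ =
      ∫ y, ‖B y‖ ^ 2 ∂mixtureMeasure d μ (a * b) (w + a ^ 2 * v) := by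
    rw [← hYm]
    exact (integral_map hY.aemeasurable (hBm.norm.pow 2).aestronglyMeasurable).symm
  have hint : Integrable (fun p : Euc d × Euc d =>
      ⟪B (a • p.1 + Real.sqrt w • p.2), A p.1⟫) ρ :=
    integrable_inner_of_norm_sq (hBm.comp_measurable hY).aestronglyMeasurable
      (hAm.comp_measurable measurable_fst).aestronglyMeasurable hB2 hA2
  have hdiff : Integrable (fun p : Euc d × Euc d => ‖B (a • p.1 + Real.sqrt w • p.2)‖ ^ 2 -
      2 * ⟪B (a • p.1 + Real.sqrt w • p.2), A p.1⟫) ρ := hB2.sub (hint.const_mul 2)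
  have hcross := integral_inner_mixtureScore hv hw ha hwa hint hμ
  simp_rw [norm_sub_sq_real]
  rw [integral_add hdiff hA2, integral_sub hB2 (hint.const_mul 2),
    integral_const_mul, hAi, hBi, hcross]
  have hFI : 0 ≤ ∫ y, ‖B y‖ ^ 2 ∂mixtureMeasure d μ (a * b) (w + a ^ 2 * v) :=
    integral_nonneg fun y => sq_nonneg _
  have ha1 : 1 ≤ a⁻¹ := (one_le_inv₀ ha).2 (by nlinarith)
  nlinarith [mul_le_mul_of_nonneg_right ha1 hFI]

end Joint

lemma ouDensity_eq_gaussianMixture (d : ℕ) (μ : Measure (Euc d)) (t : ℝ) :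
    ouDensity d μ t = gaussianMixture d μ (Real.exp (-t)) (1 - Real.exp (-2 * t)) := by
  funext x
  simp only [ouDensity, gaussianMixture, gaussianKernel, integral_const_mul]

lemma ouFlow_eq_mixtureMeasure (d : ℕ) (μ : Measure (Euc d)) (t : ℝ) :
    ouFlow d μ t = mixtureMeasure d μ (Real.exp (-t)) (1 - Real.exp (-2 * t)) := by
  rw [ouFlow, mixtureMeasure, ouDensity_eq_gaussianMixture]

lemma one_sub_exp_neg_two_mul_pos {t : ℝ} (ht : 0 < t) : 0 < 1 - Real.exp (-2 * t) :=
  sub_pos.2 (Real.exp_lt_one_iff.2 (by linarith))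

lemma relScore_eq_mixtureScore (d : ℕ) (μ : Measure (Euc d)) [IsProbabilityMeasure μ] {t : ℝ}
    (ht : 0 < t) :
    relScore d μ t = mixtureScore d μ (Real.exp (-t)) (1 - Real.exp (-2 * t)) := by
  funext x
  rw [relScore, ouDensity_eq_gaussianMixture, mixtureScore,
    gradient_log_gaussianMixture_add_self (one_sub_exp_neg_two_mul_pos ht)]

/-- Magic lemma II. There is a universal constant `C` such that for every
probability measure `μ` on `ℝ^d` with finite second moment and `0 < s < t`, with
`X ∼ μ_s`, `Z ∼ γ_d` independent, and `Y = e^{−(t−s)}X + √(1−e^{−2(t−s)})Z ∼ μ_t`,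
`E‖(∇log p_t(Y)+Y) − (∇log p_s(X)+X)‖² ≤ C (FI(μ_s‖γ_d) − FI(μ_t‖γ_d))`. -/
theorem statement_2 :
    ∃ C : ℝ, 0 < C ∧
      ∀ (d : ℕ), 1 ≤ d →
        ∀ (μ : Measure (Euc d)), IsProbabilityMeasure μ →
          Integrable (fun y => ‖y‖ ^ 2) μ →
            ∀ s t : ℝ, 0 < s → s < t →
              (∫ p : Euc d × Euc d,
                  ‖relScore d μ t
                      (Real.exp (-(t - s)) • p.1 +
                        Real.sqrt (1 - Real.exp (-2 * (t - s))) • p.2) -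
                    relScore d μ s p.1‖ ^ 2
                  ∂((ouFlow d μ s).prod (stdGaussian d))) ≤
                C * (relFisher d μ s - relFisher d μ t) := by
  refine ⟨1, one_pos, fun d _ μ hμ hμ2 s t hs hst => ?_⟩
  have hsq : ∀ r : ℝ, Real.exp (-2 * r) = Real.exp (-r) ^ 2 := fun r => by
    rw [← Real.exp_nat_mul]; congr 1; push_cast; ring
  have hab : Real.exp (-t) = Real.exp (-(t - s)) * Real.exp (-s) := by
    rw [← Real.exp_add]; congr 1; ring
  have hvt : 1 - Real.exp (-2 * t) = 1 - Real.exp (-2 * (t - s)) +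
      Real.exp (-(t - s)) ^ 2 * (1 - Real.exp (-2 * s)) := by
    rw [hsq t, hsq s, hsq (t - s), hab]; ring
  have h := integral_norm_sq_mixtureScore_sub_le (d := d) (μ := μ) (b := Real.exp (-s))
    (one_sub_exp_neg_two_mul_pos hs) (one_sub_exp_neg_two_mul_pos (sub_pos.2 hst))
    (Real.exp_pos (-(t - s))) (by rw [hsq (t - s)]) hμ2
  rw [← hvt, ← hab] at h
  rw [one_mul, relFisher, relFisher, relScore_eq_mixtureScore d μ hs,
    relScore_eq_mixtureScore d μ (hs.trans hst), ouFlow_eq_mixtureMeasure,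
    ouFlow_eq_mixtureMeasure]
  exact h
end
end

section
/- Let μ be a probability measure on ℝ^d with finite second moment. Then the relative Fisher information t ↦ FI(μ_t ‖ γ_d) is nonincreasing along the Ornstein–Uhlenbeck flow: for all 0 < s ≤ t, FI(μ_t ‖ γ_d) ≤ FI(μ_s ‖ γ_d). -/
open MeasureTheory Real
open scoped RealInnerProductSpace ENNReal Classical

noncomputable section

open Function Filter

/-- The density at `x` of the Gaussian measure `N(m, v I_d)` on `ℝ^d`. -/
def gaussDensity {d : ℕ} (v : ℝ) (m x : Euc d) : ℝ :=
  (2 * π * v) ^ (-(d : ℝ) / 2) * Real.exp (-‖x - m‖ ^ 2 / (2 * v))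

section GaussDensity

variable {d : ℕ} {v : ℝ}

lemma gaussDensity_pos (hv : 0 < v) (m x : Euc d) : 0 < gaussDensity v m x := by
  unfold gaussDensity; positivity

lemma gaussDensity_le (hv : 0 < v) (m x : Euc d) :
    gaussDensity v m x ≤ (2 * π * v) ^ (-(d : ℝ) / 2) := by
  unfold gaussDensity
  refine mul_le_of_le_one_right (by positivity) (Real.exp_le_one_iff.2 ?_)
  rw [neg_div, neg_nonpos]
  positivity

@[fun_prop]
lemma Continuous.gaussDensity {X : Type*} [TopologicalSpace X] {f g : X → Euc d}
    (hf : Continuous f) (hg : Continuous g) :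
    Continuous fun x => gaussDensity v (f x) (g x) := by
  unfold _root_.gaussDensity; fun_prop

lemma gaussDensity_eq_sub (m x : Euc d) : gaussDensity v m x = gaussDensity v 0 (x - m) := by
  simp [gaussDensity]

lemma gaussDensity_zero_eq (x : Euc d) :
    gaussDensity v 0 x = (2 * π * v) ^ (-(d : ℝ) / 2) * Real.exp (-(2 * v)⁻¹ * ‖x‖ ^ 2) := by
  simp only [gaussDensity, sub_zero]
  congr 2
  rw [div_eq_mul_inv]; ring

lemma integrable_exp_neg_mul_sq_norm {b : ℝ} (hb : 0 < b) :
    Integrable fun x : Euc d => Real.exp (-b * ‖x‖ ^ 2) := by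
  by_contra h
  have := GaussianFourier.integral_rexp_neg_mul_sq_norm (V := Euc d) hb
  rw [integral_undef h] at this
  have : 0 < (π / b) ^ (Module.finrank ℝ (Euc d) / 2 : ℝ) := by positivity
  linarith

lemma integrable_gaussDensity (hv : 0 < v) (m : Euc d) :
    Integrable fun x => gaussDensity v m x := by
  have h : Integrable fun x : Euc d => gaussDensity v 0 x := by
    simp only [gaussDensity_zero_eq]
    exact (integrable_exp_neg_mul_sq_norm (by positivity)).const_mul _
  simpa only [← gaussDensity_eq_sub] using h.comp_sub_right m

lemma integral_gaussDensity (hv : 0 < v) (m : Euc d) :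
    ∫ x, gaussDensity v m x = 1 := by
  simp_rw [gaussDensity_eq_sub m]
  rw [integral_sub_right_eq_self (fun x => gaussDensity v 0 x) m]
  simp only [gaussDensity_zero_eq]
  rw [integral_const_mul, GaussianFourier.integral_rexp_neg_mul_sq_norm (by positivity)]
  have : π / (2 * v)⁻¹ = 2 * π * v := by field_simp
  rw [this, finrank_euclideanSpace_fin, ← Real.rpow_add (by positivity), neg_div, neg_add_cancel,
    Real.rpow_zero]

lemma integrable_gaussDensity_mul_sq_norm (hv : 0 < v) :
    Integrable fun x : Euc d => gaussDensity v 0 x * ‖x‖ ^ 2 := by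
  have hb : 0 < (4 * v)⁻¹ := by positivity
  refine (((integrable_exp_neg_mul_sq_norm hb).const_mul (4 * v)).const_mul
    ((2 * π * v) ^ (-(d : ℝ) / 2))).mono' (by fun_prop) (.of_forall fun x => ?_)
  rw [Real.norm_of_nonneg (mul_nonneg (gaussDensity_pos hv _ _).le (sq_nonneg _)),
    gaussDensity_zero_eq, mul_assoc]
  refine mul_le_mul_of_nonneg_left ?_ (by positivity)
  have h1 : (4 * v)⁻¹ * ‖x‖ ^ 2 ≤ Real.exp ((4 * v)⁻¹ * ‖x‖ ^ 2) := by
    linarith [Real.add_one_le_exp ((4 * v)⁻¹ * ‖x‖ ^ 2)]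
  have h2 : -(2 * v)⁻¹ * ‖x‖ ^ 2 = -(4 * v)⁻¹ * ‖x‖ ^ 2 + -(4 * v)⁻¹ * ‖x‖ ^ 2 := by
    field_simp; ring
  calc Real.exp (-(2 * v)⁻¹ * ‖x‖ ^ 2) * ‖x‖ ^ 2
      = (4 * v) * (Real.exp (-(4 * v)⁻¹ * ‖x‖ ^ 2) *
          (Real.exp (-(4 * v)⁻¹ * ‖x‖ ^ 2) * ((4 * v)⁻¹ * ‖x‖ ^ 2))) := by
        rw [h2, Real.exp_add]; field_simp
    _ ≤ (4 * v) * (Real.exp (-(4 * v)⁻¹ * ‖x‖ ^ 2) *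
          (Real.exp (-(4 * v)⁻¹ * ‖x‖ ^ 2) * Real.exp ((4 * v)⁻¹ * ‖x‖ ^ 2))) := by gcongr
    _ = (4 * v) * Real.exp (-(4 * v)⁻¹ * ‖x‖ ^ 2) := by
        rw [← Real.exp_add (-(4 * v)⁻¹ * ‖x‖ ^ 2) ((4 * v)⁻¹ * ‖x‖ ^ 2)]; simp

lemma integrable_gaussDensity_smul_sub (hv : 0 < v) (m : Euc d) :
    Integrable fun x => gaussDensity v m x • (x - m) := by
  have h : Integrable fun x : Euc d => gaussDensity v 0 x • x := by
    refine ((integrable_gaussDensity hv 0).add (integrable_gaussDensity_mul_sq_norm hv)).mono'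
      (by fun_prop) (.of_forall fun x => ?_)
    have := (gaussDensity_pos hv 0 x).le
    rw [norm_smul, Real.norm_of_nonneg this]
    simp only [Pi.add_apply]
    nlinarith [mul_nonneg this (sq_nonneg (‖x‖ - 1)), mul_nonneg this (sq_nonneg ‖x‖)]
  simpa only [← gaussDensity_eq_sub] using h.comp_sub_right m

lemma integrable_gaussDensity_smul (hv : 0 < v) (m : Euc d) :
    Integrable fun x => gaussDensity v m x • x := by
  refine ((integrable_gaussDensity_smul_sub hv m).add
    ((integrable_gaussDensity hv m).smul_const m)).congr (.of_forall fun x => ?_)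
  simp [← smul_add]

lemma integral_gaussDensity_smul (hv : 0 < v) (m : Euc d) :
    ∫ x, gaussDensity v m x • x = m := by
  have h0 : ∫ x : Euc d, gaussDensity v 0 x • x = 0 := by
    have h := integral_neg_eq_self (fun x : Euc d => gaussDensity v 0 x • x) volume
    have h' : ∀ x : Euc d, gaussDensity v 0 (-x) = gaussDensity v 0 x := fun x => by
      simp [gaussDensity]
    simp only [h', smul_neg, integral_neg] at h
    have h2 : (2 : ℝ) • ∫ x : Euc d, gaussDensity v 0 x • x = 0 := by
      rw [two_smul]
      exact eq_neg_iff_add_eq_zero.1 h.symm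
    exact (smul_eq_zero.1 h2).resolve_left two_ne_zero
  have h1 : ∫ x, gaussDensity v m x • (x - m) = 0 := by
    rw [← h0, ← integral_sub_right_eq_self (fun x : Euc d => gaussDensity v 0 x • x) m]
    simp only [← gaussDensity_eq_sub]
  have h2 : ∀ x, gaussDensity v m x • x = gaussDensity v m x • (x - m) + gaussDensity v m x • m :=
    fun x => by rw [← smul_add, sub_add_cancel]
  simp_rw [h2]
  rw [integral_add (integrable_gaussDensity_smul_sub hv m)
    ((integrable_gaussDensity hv m).smul_const m), h1, integral_smul_const,
    integral_gaussDensity hv, one_smul, zero_add]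

/-- The joint density of a Gaussian vector and a Gaussian perturbation of a multiple of it,
disintegrated along the second marginal. -/
lemma gaussDensity_mul_gaussDensity {A B C c : ℝ} (hA : 0 < A) (hC : 0 < C)
    (hB : B = C + c ^ 2 * A) (m x z : Euc d) :
    gaussDensity A m z * gaussDensity C (c • z) x =
      gaussDensity B (c • m) x *
        gaussDensity (A * C / B) ((C / B) • m + (c * A / B) • x) z := by
  have hB0 : 0 < B := by rw [hB]; positivity
  simp only [gaussDensity]
  rw [mul_mul_mul_comm _ _ ((2 * π * C) ^ (-(d : ℝ) / 2)),
    mul_mul_mul_comm _ _ ((2 * π * (A * C / B)) ^ (-(d : ℝ) / 2)), ← Real.mul_rpow (by positivity) (by positivity),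
    ← Real.mul_rpow (by positivity) (by positivity), ← Real.exp_add, ← Real.exp_add]
  congr 2
  · field_simp
  · simp only [← real_inner_self_eq_norm_sq, inner_sub_left, inner_sub_right, inner_add_left,
      inner_add_right, real_inner_smul_left, real_inner_smul_right, real_inner_comm m z,
      real_inner_comm m x, real_inner_comm z x]
    field_simp
    rw [hB]
    ring

lemma gaussDensity_comm (m x : Euc d) : gaussDensity v m x = gaussDensity v x m := by
  simp [gaussDensity, norm_sub_rev]

lemma gaussDensity_mul_sq_norm_le (hv : 0 < v) (m x : Euc d) :
    gaussDensity v m x * ‖x - m‖ ^ 2 ≤ (2 * π * v) ^ (-(d : ℝ) / 2) * (2 * v) := by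
  rw [gaussDensity, mul_assoc]
  refine mul_le_mul_of_nonneg_left ?_ (by positivity)
  have h := Real.add_one_le_exp (‖x - m‖ ^ 2 / (2 * v))
  have h' : ‖x - m‖ ^ 2 ≤ 2 * v * Real.exp (‖x - m‖ ^ 2 / (2 * v)) := by
    rw [← div_le_iff₀' (by positivity)]; linarith
  calc Real.exp (-‖x - m‖ ^ 2 / (2 * v)) * ‖x - m‖ ^ 2
      ≤ Real.exp (-‖x - m‖ ^ 2 / (2 * v)) * (2 * v * Real.exp (‖x - m‖ ^ 2 / (2 * v))) := by
        gcongr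
    _ = 2 * v := by rw [mul_left_comm, ← Real.exp_add, neg_div, neg_add_cancel, Real.exp_zero,
        mul_one]

lemma norm_gaussDensity_smul_sub_le (hv : 0 < v) (m x : Euc d) :
    ‖gaussDensity v m x • (x - m)‖ ≤ (2 * π * v) ^ (-(d : ℝ) / 2) * (1 + 2 * v) := by
  have h0 := (gaussDensity_pos hv m x).le
  have h1 := gaussDensity_le hv m x
  have h2 := gaussDensity_mul_sq_norm_le hv m x
  rw [norm_smul, Real.norm_of_nonneg h0]
  nlinarith [mul_nonneg h0 (sq_nonneg (‖x - m‖ - 1)), mul_nonneg h0 (sq_nonneg ‖x - m‖)]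

lemma hasFDerivAt_gaussDensity (m x : Euc d) :
    HasFDerivAt (fun x => gaussDensity v m x)
      (InnerProductSpace.toDual ℝ (Euc d) (-v⁻¹ • gaussDensity v m x • (x - m))) x := by
  have h1 : HasFDerivAt (fun x : Euc d => ‖x - m‖ ^ 2) (2 • innerSL ℝ (x - m)) x := by
    simpa using ((hasFDerivAt_id x).sub_const m).norm_sq
  have h2 := (((h1.neg.mul_const (2 * v)⁻¹).exp).const_mul ((2 * π * v) ^ (-(d : ℝ) / 2)))
  simp only [gaussDensity, div_eq_mul_inv] at h2 ⊢
  refine h2.congr_fderiv ?_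
  ext h
  simp
  ring

lemma hasGradientAt_integral_gaussDensity {μ : Measure (Euc d)} [IsFiniteMeasure μ] (hv : 0 < v)
    (a : ℝ) (x : Euc d) :
    HasGradientAt (fun x => ∫ y, gaussDensity v (a • y) x ∂μ)
      (∫ y, -v⁻¹ • gaussDensity v (a • y) x • (x - a • y) ∂μ) x := by
  set C := ‖v⁻¹‖ * ((2 * π * v) ^ (-(d : ℝ) / 2) * (1 + 2 * v))
  have hb : ∀ x y : Euc d, ‖-v⁻¹ • gaussDensity v (a • y) x • (x - a • y)‖ ≤ C := fun x y => by
    rw [norm_smul, norm_neg]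
    exact mul_le_mul_of_nonneg_left (norm_gaussDensity_smul_sub_le hv _ _) (norm_nonneg _)
  have hc : Continuous fun y : Euc d => InnerProductSpace.toDual ℝ (Euc d)
      (-v⁻¹ • gaussDensity v (a • y) x • (x - a • y)) :=
    (InnerProductSpace.toDual ℝ (Euc d)).continuous.comp (by fun_prop)
  have hint : Integrable (fun y => -v⁻¹ • gaussDensity v (a • y) x • (x - a • y)) μ :=
    (integrable_const C).mono' (by fun_prop) (.of_forall (hb x))
  have hint' : Integrable (fun y => InnerProductSpace.toDual ℝ (Euc d)
      (-v⁻¹ • gaussDensity v (a • y) x • (x - a • y))) μ :=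
    (integrable_const C).mono' hc.aestronglyMeasurable
      (.of_forall fun y => by rw [LinearIsometryEquiv.norm_map]; exact hb x y)
  have := hasFDerivAt_integral_of_dominated_of_fderiv_le (μ := μ) (x₀ := x) (s := Set.univ)
    (F := fun x y => gaussDensity v (a • y) x)
    (F' := fun x y => InnerProductSpace.toDual ℝ (Euc d)
      (-v⁻¹ • gaussDensity v (a • y) x • (x - a • y)))
    (bound := fun _ => C) univ_mem (.of_forall fun x => by fun_prop)
    ((integrable_const ((2 * π * v) ^ (-(d : ℝ) / 2))).mono' (by fun_prop)
      (.of_forall fun y => by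
        rw [Real.norm_of_nonneg (gaussDensity_pos hv _ _).le]; exact gaussDensity_le hv _ _))
    hc.aestronglyMeasurable
    (.of_forall fun y x _ => by rw [LinearIsometryEquiv.norm_map]; exact hb x y)
    (integrable_const C) (.of_forall fun y x _ => hasFDerivAt_gaussDensity (a • y) x)
  rw [hasGradientAt_iff_hasFDerivAt]
  refine this.congr_fderiv ?_
  ext h
  rw [ContinuousLinearMap.integral_apply hint']
  simp only [InnerProductSpace.toDual_apply_apply]
  simp_rw [real_inner_comm h]
  exact integral_inner hint h

/-- Fubini for the composition of two Gaussian kernels against a function of linear growth. -/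
lemma integral_gaussDensity_smul_integral {F : Type*} [NormedAddCommGroup F] [NormedSpace ℝ F]
    [SecondCountableTopology F] {μ : Measure (Euc d)}
    [IsFiniteMeasure μ] (hmom : Integrable (fun y => ‖y‖) μ) {A B C a c : ℝ} (hA : 0 < A)
    (hC : 0 < C) (hc : c ≠ 0) (hB : B = C + c ^ 2 * A) {w : Euc d → Euc d → F}
    (hw : Continuous (uncurry w)) {K : ℝ} (hwK : ∀ z y, ‖w z y‖ ≤ K * (1 + ‖y‖ + ‖z‖))
    (x : Euc d) :
    ∫ z, gaussDensity C (c • z) x • ∫ y, gaussDensity A (a • y) z • w z y ∂μ =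
      ∫ y, gaussDensity B (c • a • y) x •
        (∫ z, gaussDensity (A * C / B) ((C / B) • a • y + (c * A / B) • x) z • w z y) ∂μ := by
  have key : ∀ z y : Euc d, gaussDensity B (c • a • y) x •
      gaussDensity (A * C / B) ((C / B) • a • y + (c * A / B) • x) z • w z y =
        gaussDensity C (c • z) x • gaussDensity A (a • y) z • w z y := fun z y => by
    rw [smul_smul, ← gaussDensity_mul_gaussDensity hA hC hB, mul_comm, mul_smul]
  simp_rw [← integral_smul, key]
  rw [integral_integral_swap]
  have h1 : Integrable fun z : Euc d => gaussDensity C (c • z) x := by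
    simpa only [gaussDensity_comm _ x] using (integrable_gaussDensity hC x).comp_smul hc
  have h2 : Integrable fun z : Euc d => gaussDensity C (c • z) x * ‖z‖ := by
    refine (((integrable_gaussDensity_smul hC x).comp_smul hc).norm.const_mul |c|⁻¹).congr
      (.of_forall fun z => ?_)
    have := abs_ne_zero.2 hc
    simp only [norm_smul, Real.norm_eq_abs, abs_of_pos (gaussDensity_pos hC _ _)]
    rw [gaussDensity_comm]; field_simp
  have hw' : Continuous fun p : Euc d × Euc d => w p.1 p.2 := hw
  refine (((h1.mul_prod ((integrable_const (1 : ℝ)).add hmom)).add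
    (h2.mul_prod (integrable_const (1 : ℝ)))).const_mul
      ((2 * π * A) ^ (-(d : ℝ) / 2) * K)).mono' ?_ (.of_forall fun p => ?_)
  · refine Continuous.aestronglyMeasurable ?_
    unfold uncurry
    fun_prop
  · have hC' := (gaussDensity_pos hC (c • p.1) x).le
    have hA' := (gaussDensity_pos hA (a • p.2) p.1).le
    simp only [uncurry, norm_smul, Real.norm_of_nonneg hC', Real.norm_of_nonneg hA',
      Pi.add_apply]
    calc _ ≤ gaussDensity C (c • p.1) x * ((2 * π * A) ^ (-(d : ℝ) / 2) *
          (K * (1 + ‖p.2‖ + ‖p.1‖))) := by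
          gcongr
          · exact gaussDensity_le hA _ _
          · exact hwK _ _
      _ = _ := by ring

end GaussDensity

section Jensen

variable {α : Type*} [MeasurableSpace α] {ν : Measure α} {d : ℕ}

lemma sq_enorm_integral_smul_le {k : α → ℝ} (hk : Measurable k) (hk0 : ∀ y, 0 ≤ k y)
    {w : α → Euc d} (hw : Measurable w) :
    ‖∫ y, k y • w y ∂ν‖ₑ ^ 2 ≤
      (∫⁻ y, ENNReal.ofReal (k y) ∂ν) * ∫⁻ y, ENNReal.ofReal (k y) * ‖w y‖ₑ ^ 2 ∂ν := by
  have h : ‖∫ y, k y • w y ∂ν‖ₑ ≤ (∫⁻ y, ENNReal.ofReal (k y) ∂ν) ^ (1 / 2 : ℝ) *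
      (∫⁻ y, ENNReal.ofReal (k y) * ‖w y‖ₑ ^ 2 ∂ν) ^ (1 / 2 : ℝ) := by
    refine (enorm_integral_le_lintegral_enorm _).trans (le_trans (le_of_eq ?_)
      (ENNReal.lintegral_mul_norm_pow_le (by fun_prop) (by fun_prop) (by norm_num) (by norm_num)
        (by norm_num)))
    congr with y
    rw [enorm_smul, Real.enorm_of_nonneg (hk0 y),
      ENNReal.mul_rpow_of_nonneg _ _ (by norm_num : (0 : ℝ) ≤ 1 / 2), ← mul_assoc,
      ← ENNReal.rpow_add_of_nonneg _ _ (by norm_num) (by norm_num), ← ENNReal.rpow_natCast,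
      ← ENNReal.rpow_mul]
    norm_num
  refine (pow_le_pow_left' h 2).trans (le_of_eq ?_)
  rw [mul_pow, ← ENNReal.rpow_natCast, ← ENNReal.rpow_natCast, ← ENNReal.rpow_mul,
    ← ENNReal.rpow_mul]
  norm_num

/-- Jensen's inequality for the squared norm of weighted averages, integrated over the
parameter. -/
lemma lintegral_sq_enorm_average_le [SFinite ν] {β : Type*} [MeasurableSpace β] {ρ : Measure β}
    [SFinite ρ] {k : β → α → ℝ} (hk : Measurable (uncurry k)) (hk0 : ∀ x y, 0 ≤ k x y)
    (hki : ∀ x, Integrable (k x) ν) {w : β → α → Euc d} (hw : Measurable (uncurry w)) :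
    ∫⁻ x, ENNReal.ofReal (∫ y, k x y ∂ν) *
        ‖(∫ y, k x y ∂ν)⁻¹ • ∫ y, k x y • w x y ∂ν‖ₑ ^ 2 ∂ρ ≤
      ∫⁻ y, ∫⁻ x, ENNReal.ofReal (k x y) * ‖w x y‖ₑ ^ 2 ∂ρ ∂ν := by
  rw [← lintegral_lintegral_swap (by fun_prop)]
  refine lintegral_mono fun x => ?_
  have hp : 0 ≤ ∫ y, k x y ∂ν := integral_nonneg (hk0 x)
  have h := sq_enorm_integral_smul_le (ν := ν) (k := k x) (w := w x)
    (by fun_prop) (hk0 x) (by fun_prop)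
  rw [← ofReal_integral_eq_lintegral_ofReal (hki x) (.of_forall (hk0 x))] at h
  rcases hp.eq_or_lt with hp | hp
  · simp [← hp]
  have hp' : ENNReal.ofReal (∫ y, k x y ∂ν) ≠ 0 := by simpa using hp
  rw [enorm_smul, mul_pow, Real.enorm_of_nonneg (inv_nonneg.2 hp.le), ENNReal.ofReal_inv_of_pos hp]
  set P := ENNReal.ofReal (∫ y, k x y ∂ν)
  have hP : P ≠ ⊤ := ENNReal.ofReal_ne_top
  calc P * (P⁻¹ ^ 2 * ‖∫ y, k x y • w x y ∂ν‖ₑ ^ 2)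
      = (P * P⁻¹) * (P⁻¹ * ‖∫ y, k x y • w x y ∂ν‖ₑ ^ 2) := by ring
    _ ≤ (P * P⁻¹) * (P⁻¹ * (P * ∫⁻ y, ENNReal.ofReal (k x y) * ‖w x y‖ₑ ^ 2 ∂ν)) := by gcongr
    _ = ∫⁻ y, ENNReal.ofReal (k x y) * ‖w x y‖ₑ ^ 2 ∂ν := by
      rw [← mul_assoc P⁻¹, ENNReal.inv_mul_cancel hp' hP, ENNReal.mul_inv_cancel hp' hP, one_mul,
        one_mul]

end Jensen

section OrnsteinUhlenbeck

variable {d : ℕ} {μ : Measure (Euc d)} {t : ℝ}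

lemma one_sub_exp_neg_sq_pos (ht : 0 < t) : 0 < 1 - Real.exp (-t) ^ 2 := by
  have := Real.exp_lt_one_iff.2 (neg_lt_zero.2 ht)
  nlinarith [Real.exp_pos (-t)]

lemma ouDensity_eq_integral_gaussDensity (x : Euc d) : ouDensity d μ t x =
    ∫ y, gaussDensity (1 - Real.exp (-t) ^ 2) (Real.exp (-t) • y) x ∂μ := by
  simp only [ouDensity, gaussDensity, ← integral_const_mul, ← Real.exp_nat_mul]
  norm_num

lemma integrable_gaussDensity_mean [IsFiniteMeasure μ] {v : ℝ} (hv : 0 < v) (a : ℝ) (x : Euc d) :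
    Integrable (fun y => gaussDensity v (a • y) x) μ :=
  (integrable_const ((2 * π * v) ^ (-(d : ℝ) / 2))).mono' (by fun_prop) (.of_forall fun y => by
    rw [Real.norm_of_nonneg (gaussDensity_pos hv _ _).le]; exact gaussDensity_le hv _ _)

lemma ouDensity_pos [IsProbabilityMeasure μ] (ht : 0 < t) (x : Euc d) : 0 < ouDensity d μ t x := by
  have hv := one_sub_exp_neg_sq_pos ht
  rw [ouDensity_eq_integral_gaussDensity, integral_pos_iff_support_of_nonneg
    (fun y => (gaussDensity_pos hv _ _).le) (integrable_gaussDensity_mean hv _ _)]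
  have : support (fun y => gaussDensity (1 - Real.exp (-t) ^ 2) (Real.exp (-t) • y) x) = Set.univ :=
    Set.eq_univ_of_forall fun y => (gaussDensity_pos hv _ _).ne'
  simp [this]

lemma measurable_ouDensity [SFinite μ] : Measurable (ouDensity d μ t) := by
  rw [funext fun x => ouDensity_eq_integral_gaussDensity (μ := μ) (t := t) x]
  refine (StronglyMeasurable.integral_prod_right (f := fun x y =>
    gaussDensity (1 - Real.exp (-t) ^ 2) (Real.exp (-t) • y) x) ?_).measurable
  exact Continuous.stronglyMeasurable (by unfold uncurry; fun_prop)

/-- Tweedie's formula: the relative score is a posterior average. -/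
lemma relScore_eq [IsProbabilityMeasure μ] (ht : 0 < t) (x : Euc d) :
    relScore d μ t x = (ouDensity d μ t x)⁻¹ •
      ∫ y, gaussDensity (1 - Real.exp (-t) ^ 2) (Real.exp (-t) • y) x •
        (Real.exp (-t) / (1 - Real.exp (-t) ^ 2)) • (y - Real.exp (-t) • x) ∂μ := by
  have hp := ouDensity_pos (μ := μ) ht x
  have hv := one_sub_exp_neg_sq_pos ht
  have hg := hasGradientAt_integral_gaussDensity (μ := μ) hv (Real.exp (-t)) x
  have hpe := ouDensity_eq_integral_gaussDensity (μ := μ) (t := t)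
  simp_rw [← hpe] at hg
  set a := Real.exp (-t)
  set v := 1 - a ^ 2
  have hl : HasGradientAt (fun z => Real.log (ouDensity d μ t z)) ((ouDensity d μ t x)⁻¹ •
      ∫ y, -v⁻¹ • gaussDensity v (a • y) x • (x - a • y) ∂μ) x := by
    rw [hasGradientAt_iff_hasFDerivAt] at hg ⊢
    simpa using hg.log hp.ne'
  have hx : x = (ouDensity d μ t x)⁻¹ • ∫ y, gaussDensity v (a • y) x • x ∂μ := by
    rw [integral_smul_const, ← hpe, smul_smul, inv_mul_cancel₀ hp.ne', one_smul]
  have hi : Integrable (fun y => -v⁻¹ • gaussDensity v (a • y) x • (x - a • y)) μ :=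
    ((integrable_const ((2 * π * v) ^ (-(d : ℝ) / 2) * (1 + 2 * v))).mono' (by fun_prop)
      (.of_forall fun y => norm_gaussDensity_smul_sub_le hv _ _)).smul (-v⁻¹)
  rw [relScore, hl.gradient]
  conv_lhs => arg 2; rw [hx]
  rw [← smul_add, ← integral_add hi
    ((integrable_gaussDensity_mean hv a x).smul_const x)]
  congr 2 with y : 1
  rw [smul_comm, ← smul_add]
  congr 1
  have hv' : v ≠ 0 := hv.ne'
  match_scalars
  · field_simp
    simp only [v]
    ring
  · field_simp

lemma measurable_relScore [IsProbabilityMeasure μ] (ht : 0 < t) : Measurable (relScore d μ t) := by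
  rw [funext fun x => relScore_eq (μ := μ) ht x]
  refine measurable_ouDensity.inv.smul (StronglyMeasurable.integral_prod_right (f := fun x y =>
    gaussDensity (1 - Real.exp (-t) ^ 2) (Real.exp (-t) • y) x •
        (Real.exp (-t) / (1 - Real.exp (-t) ^ 2)) • (y - Real.exp (-t) • x)) ?_).measurable
  exact Continuous.stronglyMeasurable (by unfold uncurry; fun_prop)

lemma relFisher_eq_toReal [IsProbabilityMeasure μ] (ht : 0 < t) :
    relFisher d μ t =
      (∫⁻ x, ENNReal.ofReal (ouDensity d μ t x) * ‖relScore d μ t x‖ₑ ^ 2).toReal := by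
  have hm := measurable_relScore (μ := μ) ht
  rw [relFisher, integral_eq_lintegral_of_nonneg_ae (.of_forall fun x => by positivity)
    (by fun_prop), ouFlow, lintegral_withDensity_eq_lintegral_mul _
      measurable_ouDensity.ennreal_ofReal (by fun_prop)]
  congr with x
  simp [ENNReal.ofReal_pow]

lemma lintegral_relScore_lt_top [IsProbabilityMeasure μ]
    (hmom : Integrable (fun y => ‖y‖ ^ 2) μ) (ht : 0 < t) :
    ∫⁻ x, ENNReal.ofReal (ouDensity d μ t x) * ‖relScore d μ t x‖ₑ ^ 2 < ⊤ := by
  have hv := one_sub_exp_neg_sq_pos ht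
  simp_rw [relScore_eq (μ := μ) ht, ouDensity_eq_integral_gaussDensity]
  have ha0 := Real.exp_pos (-t)
  have ha1 := Real.exp_lt_one_iff.2 (neg_lt_zero.2 ht)
  set a := Real.exp (-t)
  set v := 1 - a ^ 2 with hv_def
  set M := ∫ x : Euc d, gaussDensity v 0 x * ‖x‖ ^ 2
  refine (lintegral_sq_enorm_average_le (ν := μ) (ρ := volume)
    (k := fun x y => gaussDensity v (a • y) x) (w := fun x y => (a / v) • (y - a • x))
    (Continuous.measurable (by unfold uncurry; fun_prop)) (fun x y => (gaussDensity_pos hv _ _).le)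
    (fun x => integrable_gaussDensity_mean hv a x)
    (Continuous.measurable (by unfold uncurry; fun_prop))).trans_lt ?_
  have hbound : ∀ y : Euc d, ∫⁻ x, ENNReal.ofReal (gaussDensity v (a • y) x) *
      ‖(a / v) • (y - a • x)‖ₑ ^ 2 ≤
        ENNReal.ofReal ((a / v) ^ 2 * 2 * ‖y‖ ^ 2 + (a / v) ^ 2 * 2 * M) := fun y => by
    have hi1 := (integrable_gaussDensity hv (a • y)).const_mul ((a / v) ^ 2 * 2 * ‖y‖ ^ 2)
    have hi2 := ((integrable_gaussDensity_mul_sq_norm (d := d) hv).comp_sub_right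
      (a • y)).const_mul ((a / v) ^ 2 * 2)
    have hi12 : Integrable (fun x => (a / v) ^ 2 * 2 * ‖y‖ ^ 2 * gaussDensity v (a • y) x +
        (a / v) ^ 2 * 2 * (gaussDensity v 0 (x - a • y) * ‖x - a • y‖ ^ 2)) := hi1.add hi2
    have hM : ∫ x, gaussDensity v 0 (x - a • y) * ‖x - a • y‖ ^ 2 = M :=
      integral_sub_right_eq_self (fun x : Euc d => gaussDensity v 0 x * ‖x‖ ^ 2) (a • y)
    rw [← hM, ← integral_const_mul, ← mul_one ((a / v) ^ 2 * 2 * ‖y‖ ^ 2),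
      ← integral_gaussDensity hv (a • y), ← integral_const_mul, ← integral_add hi1 hi2,
      ofReal_integral_eq_lintegral_ofReal hi12 (.of_forall fun x => ?_)]
    · refine lintegral_mono fun x => ?_
      have hg := (gaussDensity_pos hv (a • y) x).le
      rw [← ofReal_norm, ← ENNReal.ofReal_pow (norm_nonneg _), ← ENNReal.ofReal_mul hg]
      refine ENNReal.ofReal_le_ofReal ?_
      rw [← gaussDensity_eq_sub, norm_smul, mul_pow, Real.norm_eq_abs, sq_abs]
      have h1 : ‖y - a • x‖ ≤ ‖y‖ + ‖x - a • y‖ := by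
        have : y - a • x = v • y - a • (x - a • y) := by
          rw [hv_def]; match_scalars <;> ring
        rw [this]
        refine (norm_sub_le _ _).trans ?_
        rw [norm_smul, norm_smul, Real.norm_of_nonneg hv.le, Real.norm_of_nonneg ha0.le]
        gcongr
        · exact mul_le_of_le_one_left (norm_nonneg _) (by nlinarith)
        · exact mul_le_of_le_one_left (norm_nonneg _) ha1.le
      have h2 : ‖y - a • x‖ ^ 2 ≤ 2 * ‖y‖ ^ 2 + 2 * ‖x - a • y‖ ^ 2 := by
        nlinarith [sq_nonneg (‖y‖ - ‖x - a • y‖), norm_nonneg (y - a • x)]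
      calc _ ≤ gaussDensity v (a • y) x *
            ((a / v) ^ 2 * (2 * ‖y‖ ^ 2 + 2 * ‖x - a • y‖ ^ 2)) := by gcongr
        _ = _ := by ring
    · have := (gaussDensity_pos hv (a • y) x).le
      have := (gaussDensity_pos hv 0 (x - a • y)).le
      simp only [Pi.zero_apply]
      positivity
  exact (lintegral_mono hbound).trans_lt
    ((hmom.const_mul ((a / v) ^ 2 * 2)).add (integrable_const _)).lintegral_lt_top

lemma integral_ouFlow [IsProbabilityMeasure μ] {F : Type*} [NormedAddCommGroup F]
    [NormedSpace ℝ F] (ht : 0 < t) (g : Euc d → F) :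
    ∫ z, g z ∂(ouFlow d μ t) = ∫ z, ouDensity d μ t z • g z := by
  rw [ouFlow, integral_withDensity_eq_integral_toReal_smul measurable_ouDensity.ennreal_ofReal
    (.of_forall fun _ => ENNReal.ofReal_lt_top)]
  simp_rw [ENNReal.toReal_ofReal (ouDensity_pos ht _).le]

/-- The semigroup property of the Ornstein–Uhlenbeck flow. -/
lemma ouDensity_add [IsProbabilityMeasure μ] (hmom : Integrable (fun y => ‖y‖) μ) {s h : ℝ}
    (hs : 0 < s) (hh : 0 < h) (x : Euc d) :
    ouDensity d μ (s + h) x =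
      ∫ z, gaussDensity (1 - Real.exp (-h) ^ 2) (Real.exp (-h) • z) x ∂(ouFlow d μ s) := by
  have hA := one_sub_exp_neg_sq_pos hs
  have hC := one_sub_exp_neg_sq_pos hh
  have hB := one_sub_exp_neg_sq_pos (add_pos hs hh)
  rw [integral_ouFlow hs]
  simp_rw [ouDensity_eq_integral_gaussDensity]
  have hc := Real.exp_pos (-h)
  have hmul : Real.exp (-(s + h)) = Real.exp (-h) * Real.exp (-s) := by
    rw [← Real.exp_add]; ring_nf
  rw [hmul] at hB ⊢
  set a := Real.exp (-s)
  set c := Real.exp (-h)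
  have := integral_gaussDensity_smul_integral (μ := μ) hmom (a := a) hA hC hc.ne'
    (B := 1 - (c * a) ^ 2) (by ring) (w := fun _ _ => (1 : ℝ)) (by unfold uncurry; fun_prop)
    (K := 1) (fun z y => by
      rw [norm_one, one_mul]; linarith [norm_nonneg y, norm_nonneg z]) x
  simp only [smul_eq_mul, mul_one] at this
  simp_rw [integral_gaussDensity (div_pos (mul_pos hA hC) hB), mul_one, smul_smul] at this
  rw [← this]
  congr 1
  funext z
  rw [smul_eq_mul, mul_comm]

/-- The relative score contracts by `exp (-h)` under averaging over the flow of duration `h`. -/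
lemma ouDensity_smul_relScore_add [IsProbabilityMeasure μ] (hmom : Integrable (fun y => ‖y‖) μ)
    {s h : ℝ} (hs : 0 < s) (hh : 0 < h) (x : Euc d) :
    ouDensity d μ (s + h) x • relScore d μ (s + h) x =
      ∫ z, gaussDensity (1 - Real.exp (-h) ^ 2) (Real.exp (-h) • z) x •
        Real.exp (-h) • relScore d μ s z ∂(ouFlow d μ s) := by
  have hA := one_sub_exp_neg_sq_pos hs
  have hC := one_sub_exp_neg_sq_pos hh
  have hB := one_sub_exp_neg_sq_pos (add_pos hs hh)
  rw [integral_ouFlow hs]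
  have hz : ∀ z, ouDensity d μ s z • gaussDensity (1 - Real.exp (-h) ^ 2) (Real.exp (-h) • z) x •
      Real.exp (-h) • relScore d μ s z =
        Real.exp (-h) • gaussDensity (1 - Real.exp (-h) ^ 2) (Real.exp (-h) • z) x •
          ouDensity d μ s z • relScore d μ s z := fun z => by
    simp only [smul_smul]; ring_nf
  simp_rw [hz, relScore_eq hs, relScore_eq (add_pos hs hh),
    smul_inv_smul₀ (ouDensity_pos hs _).ne',
    smul_inv_smul₀ (ouDensity_pos (add_pos hs hh) _).ne']
  have hc := Real.exp_pos (-h)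
  have ha := Real.exp_pos (-s)
  have hmul : Real.exp (-(s + h)) = Real.exp (-h) * Real.exp (-s) := by
    rw [← Real.exp_add]; ring_nf
  rw [hmul] at hB ⊢
  set a := Real.exp (-s)
  set c := Real.exp (-h)
  set A := 1 - a ^ 2 with hA_def
  set C := 1 - c ^ 2 with hC_def
  set B := 1 - (c * a) ^ 2 with hB_def
  have hτ := div_pos (mul_pos hA hC) hB
  rw [integral_smul, integral_gaussDensity_smul_integral (μ := μ) hmom (a := a) hA hC hc.ne'
    (B := B) (by rw [hA_def, hB_def, hC_def]; ring) (w := fun z y => (a / A) • (y - a • z))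
    (by unfold uncurry; fun_prop) (K := a / A * (1 + a)) (fun z y => ?_) x, ← integral_smul]
  · congr 1
    funext y
    set m := (C / B) • a • y + (c * A / B) • x
    have hin : ∫ z, gaussDensity (A * C / B) m z • (a / A) • (y - a • z) =
        (a / A) • (y - a • m) := by
      have hz : ∀ z, gaussDensity (A * C / B) m z • (a / A) • (y - a • z) =
          (a / A) • (gaussDensity (A * C / B) m z • y - a • gaussDensity (A * C / B) m z • z) :=
        fun z => by module
      simp_rw [hz]
      rw [integral_smul, integral_sub ((integrable_gaussDensity hτ m).smul_const y)
        ((integrable_gaussDensity_smul hτ m).smul a : Integrable fun z =>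
          a • gaussDensity (A * C / B) m z • z),
        integral_smul_const, integral_smul, integral_gaussDensity hτ,
        integral_gaussDensity_smul hτ, one_smul]
    rw [hin, ← smul_smul c a y, smul_comm c (gaussDensity _ _ _)]
    congr 1
    have hA' := hA.ne'
    have hB' := hB.ne'
    simp only [m]
    match_scalars
    · field_simp
      rw [hA_def, hB_def, hC_def]; ring
    · field_simp
  · rw [norm_smul, Real.norm_of_nonneg (by positivity), mul_assoc]
    gcongr
    refine (norm_sub_le _ _).trans ?_
    rw [norm_smul, Real.norm_of_nonneg ha.le]
    nlinarith [norm_nonneg y, norm_nonneg z, mul_nonneg ha.le (norm_nonneg y)]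

lemma lintegral_relScore_add_le [IsProbabilityMeasure μ] (hmom : Integrable (fun y => ‖y‖) μ)
    {s h : ℝ} (hs : 0 < s) (hh : 0 < h) :
    ∫⁻ x, ENNReal.ofReal (ouDensity d μ (s + h) x) * ‖relScore d μ (s + h) x‖ₑ ^ 2 ≤
      ∫⁻ x, ENNReal.ofReal (ouDensity d μ s x) * ‖relScore d μ s x‖ₑ ^ 2 := by
  have hC := one_sub_exp_neg_sq_pos hh
  have hm := measurable_relScore (μ := μ) hs
  have : SFinite (ouFlow d μ s) := by unfold ouFlow; infer_instance
  have hu : ∀ x, relScore d μ (s + h) x = (ouDensity d μ (s + h) x)⁻¹ •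
      ∫ z, gaussDensity (1 - Real.exp (-h) ^ 2) (Real.exp (-h) • z) x •
        Real.exp (-h) • relScore d μ s z ∂(ouFlow d μ s) := fun x => by
    rw [← ouDensity_smul_relScore_add hmom hs hh,
      inv_smul_smul₀ (ouDensity_pos (add_pos hs hh) _).ne']
  have hki : ∀ x, Integrable (fun z => gaussDensity (1 - Real.exp (-h) ^ 2)
      (Real.exp (-h) • z) x) (ouFlow d μ s) := fun x => by
    by_contra hn
    have h0 := ouDensity_pos (μ := μ) (add_pos hs hh) x
    rw [ouDensity_add hmom hs hh, integral_undef hn] at h0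
    exact h0.false
  simp_rw [hu, ouDensity_add hmom hs hh]
  refine (lintegral_sq_enorm_average_le (k := fun x z => gaussDensity (1 - Real.exp (-h) ^ 2)
    (Real.exp (-h) • z) x) (w := fun _ z => Real.exp (-h) • relScore d μ s z)
    (Continuous.measurable (by unfold uncurry; fun_prop)) (fun x z => (gaussDensity_pos hC _ _).le)
    hki (by unfold uncurry; fun_prop)).trans ?_
  have hone : ∀ z : Euc d, ∫⁻ x, ENNReal.ofReal
      (gaussDensity (1 - Real.exp (-h) ^ 2) (Real.exp (-h) • z) x) = 1 := fun z => by
    rw [← ofReal_integral_eq_lintegral_ofReal (integrable_gaussDensity hC _)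
      (.of_forall fun x => (gaussDensity_pos hC _ _).le), integral_gaussDensity hC,
      ENNReal.ofReal_one]
  have hmeas : ∀ z : Euc d, Measurable fun x => ENNReal.ofReal
      (gaussDensity (1 - Real.exp (-h) ^ 2) (Real.exp (-h) • z) x) := fun z =>
    (Continuous.measurable (by fun_prop)).ennreal_ofReal
  simp_rw [lintegral_mul_const _ (hmeas _), hone, one_mul]
  rw [ouFlow, lintegral_withDensity_eq_lintegral_mul _ measurable_ouDensity.ennreal_ofReal
    (by fun_prop)]
  refine lintegral_mono fun z => ?_
  simp only [Pi.mul_apply]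
  gcongr
  rw [enorm_smul, Real.enorm_of_nonneg (Real.exp_pos _).le]
  refine mul_le_of_le_one_left' ?_
  rw [ENNReal.ofReal_le_one, Real.exp_le_one_iff]
  linarith

end OrnsteinUhlenbeck

/-- For a probability measure `μ` on `ℝ^d` with finite second moment, the
relative Fisher information `t ↦ FI(μ_t ‖ γ_d)` is nonincreasing along the
Ornstein–Uhlenbeck flow: for all `0 < s ≤ t`, `FI(μ_t ‖ γ_d) ≤ FI(μ_s ‖ γ_d)`. -/
theorem statement_3 (d : ℕ) (hd : 1 ≤ d)
    (μ : Measure (Euc d)) (hμ : IsProbabilityMeasure μ)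
    (hmom : Integrable (fun y => ‖y‖ ^ 2) μ)
    (s t : ℝ) (hs : 0 < s) (hst : s ≤ t) :
    relFisher d μ t ≤ relFisher d μ s := by
  rcases hst.eq_or_lt with rfl | hlt
  · rfl
  have hmom1 : Integrable (fun y => ‖y‖) μ := by
    refine (hmom.add (integrable_const 1)).mono' (by fun_prop) (.of_forall fun y => ?_)
    rw [norm_norm]
    simp only [Pi.add_apply]
    nlinarith [sq_nonneg (‖y‖ - 1), norm_nonneg y]
  have h := lintegral_relScore_add_le hmom1 hs (sub_pos.2 hlt)
  rw [add_sub_cancel] at h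
  rw [relFisher_eq_toReal hs, relFisher_eq_toReal (hs.trans hlt)]
  exact ENNReal.toReal_mono (lintegral_relScore_lt_top hmom hs).ne h
end
end
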